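/- Let (a_n), (b_n) be N-periodically modulated Jacobi parameters such that 𝔛_N(0) = ε·Id for some ε ∈ {−1, 1}, and suppose the sequences (a_n·(a_{n−1}/a_n − α_{n−1}/α_n))_{n≥1}, (a_n·(b_n/a_n − β_n/α_n))_{n≥0} and (1/a_n)_{n≥0} belong to D_1^N. Then for every z ∈ ℂ the limit h(z) = lim_{j→∞} a_{jN+N−1}²·discr X_{jN}(z) exists, and h is a polynomial of degree 2 with negative leading coefficient. Set Λ = {x ∈ ℝ : h(x) < 0} and ρ_n = Σ_{k=0}^{n} α_k/a_k. Then for every bounded continuous f : ℝ → ℝ with sup_{x∈ℝ} (1 + x²)·|f(x)| < ∞, one has (1/ρ_n) ∫ f dν_n → ∫_Λ f(x)·(1/(4·π·N·α_{N−1}))·|h'(x)|/√(−h(x)) dx as n → ∞. -/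

import Mathlib

open Filter Topology

/-- The discriminant of a `2×2` complex matrix: `discr X = (tr X)² - 4 det X`. -/
noncomputable def discr (X : Matrix (Fin 2) (Fin 2) ℂ) : ℂ :=
  (Matrix.trace X) ^ 2 - 4 * X.det

/-- The one–step transfer matrix `B_j(x)` associated with Jacobi parameters `a, b`. -/
noncomputable def jacobiB (a b : ℕ → ℝ) (j : ℕ) (x : ℂ) : Matrix (Fin 2) (Fin 2) ℂ :=
  !![0, 1; -((a (j - 1) : ℂ) / (a j : ℂ)), (x - (b j : ℂ)) / (a j : ℂ)]

/-- The `N`-step transfer matrix `X_n(x) = B_{n+N-1}(x) ⋯ B_{n+1}(x) B_n(x)`. -/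
noncomputable def transferX (a b : ℕ → ℝ) (N n : ℕ) (x : ℂ) : Matrix (Fin 2) (Fin 2) ℂ :=
  (((List.range N).map (fun k => jacobiB a b (n + k) x)).reverse).prod

/-- The one–step matrix `𝔅_j(x)` associated with the `N`-periodic parameters `α, β`. -/
noncomputable def frakB (α β : ℤ → ℝ) (j : ℤ) (x : ℂ) : Matrix (Fin 2) (Fin 2) ℂ :=
  !![0, 1; -((α (j - 1) : ℂ) / (α j : ℂ)), (x - (β j : ℂ)) / (α j : ℂ)]

/-- The periodic `N`-step matrix `𝔛_n(x) = 𝔅_{n+N-1}(x) ⋯ 𝔅_n(x)`. -/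
noncomputable def frakX (α β : ℤ → ℝ) (N : ℕ) (n : ℤ) (x : ℂ) : Matrix (Fin 2) (Fin 2) ℂ :=
  (((List.range N).map (fun k => frakB α β (n + k) x)).reverse).prod

/-- The Stolz class `D₁ᴺ`: bounded sequences with `∑ |x_{n+N} - x_n| < ∞`. -/
def MemD1N (N : ℕ) (x : ℕ → ℝ) : Prop :=
  (∃ C : ℝ, ∀ n, |x n| ≤ C) ∧ Summable (fun n => |x (n + N) - x n|)


section
open Filter Topology

namespace JZ

noncomputable def hm (H G A τ : ℝ) : ℝ := √((H - A * τ) ^ 2 + τ * G ^ 2)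
noncomputable def sg (H G A τ : ℝ) : ℝ := √((hm H G A τ + (H - A * τ)) / 2)
noncomputable def qq (H G A t : ℝ) : ℝ :=
  (|G| * √((hm H G A (t ^ 2) - (H - A * t ^ 2)) / 2)
    - 2 * A * t * √((hm H G A (t ^ 2) + (H - A * t ^ 2)) / 2)) / hm H G A (t ^ 2)

lemma hm_nonneg (H G A τ : ℝ) : 0 ≤ hm H G A τ := Real.sqrt_nonneg _

lemma hm_sq (H G A : ℝ) {τ : ℝ} (hτ : 0 ≤ τ) :
    hm H G A τ ^ 2 = (H - A * τ) ^ 2 + τ * G ^ 2 := by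
  rw [hm, Real.sq_sqrt (by positivity)]

lemma abs_le_hm (H G A : ℝ) {τ : ℝ} (hτ : 0 ≤ τ) : |H - A * τ| ≤ hm H G A τ := by
  apply Real.abs_le_sqrt
  have : 0 ≤ τ * G ^ 2 := by positivity
  linarith

lemma hm_ge_absH (H G A : ℝ) (hA : A < 0) (hΔ : 0 ≤ G ^ 2 - 4 * A * H) {τ : ℝ} (hτ : 0 ≤ τ) :
    |H| ≤ hm H G A τ := by
  apply Real.abs_le_sqrt
  rcases le_or_gt H 0 with h | h
  · nlinarith [mul_nonneg hτ hΔ, mul_nonneg (neg_nonneg.2 h) (mul_nonneg (neg_nonneg.2 hA.le) hτ), sq_nonneg (A * τ)]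
  · nlinarith [mul_nonneg h.le (mul_nonneg (neg_nonneg.2 hA.le) hτ), sq_nonneg (A * τ), mul_nonneg hτ (sq_nonneg G)]

lemma hm_ge_A (H G A : ℝ) (hA : A < 0) (hΔ : 0 ≤ G ^ 2 - 4 * A * H) {τ : ℝ} (hτ : 0 ≤ τ) :
    |A| * τ ≤ hm H G A τ := by
  apply Real.le_sqrt_of_sq_le
  rw [mul_pow, sq_abs]
  rcases le_or_gt H 0 with h | h
  · nlinarith [mul_nonneg hτ hΔ, mul_nonneg (neg_nonneg.2 h) (mul_nonneg (neg_nonneg.2 hA.le) hτ), sq_nonneg (H)]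
  · nlinarith [mul_nonneg h.le (mul_nonneg (neg_nonneg.2 hA.le) hτ), sq_nonneg (H), mul_nonneg hτ (sq_nonneg G)]

lemma hm_add_pos (H G A : ℝ) (hA : A < 0) (hΔ : 0 ≤ G ^ 2 - 4 * A * H) {τ : ℝ} (hτ : 0 < τ) :
    0 < hm H G A τ + (H - A * τ) := by
  have h1 := abs_le_hm H G A hτ.le
  have h2 := hm_sq H G A hτ.le
  have h4 := (abs_le.1 h1).1
  by_contra hcon
  have h5 : hm H G A τ = -(H - A * τ) := by linarith
  rw [h5] at h2
  have h6 : τ * G ^ 2 = 0 := by nlinarith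
  have h7 : G ^ 2 = 0 := by
    rcases mul_eq_zero.1 h6 with h | h
    · linarith
    · exact h
  have h8 : 0 ≤ H := by nlinarith
  have := hm_nonneg H G A τ
  nlinarith

lemma hasDerivAt_sg (H G A : ℝ) (hA : A < 0) (hΔ : 0 ≤ G ^ 2 - 4 * A * H) {t : ℝ} (ht : 0 < t) :
    HasDerivAt (sg H G A) (qq H G A t / (4 * t)) (t ^ 2) := by
  have hτ : 0 < t ^ 2 := by positivity
  have hmpos : 0 < hm H G A (t ^ 2) :=
    lt_of_lt_of_le (by have := abs_pos.2 hA.ne; positivity) (hm_ge_A H G A hA hΔ hτ.le)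
  have hpos := hm_add_pos H G A hA hΔ hτ
  have hsq := hm_sq H G A hτ.le
  have hin : (H - A * t ^ 2) ^ 2 + t ^ 2 * G ^ 2 ≠ 0 := by rw [← hsq]; positivity
  have hd0 : HasDerivAt (fun τ : ℝ => (H - A * τ) ^ 2 + τ * G ^ 2)
      (2 * (H - A * t ^ 2) * (-A) + G ^ 2) (t ^ 2) := by
    have h1 : HasDerivAt (fun τ : ℝ => H - A * τ) (-A) (t ^ 2) := by
      simpa using ((hasDerivAt_id (t ^ 2)).const_mul A).const_sub H
    have h2 := (h1.pow 2).add ((hasDerivAt_id (t ^ 2)).mul_const (G ^ 2))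
    refine h2.congr_deriv ?_
    simp
  have hd1 : HasDerivAt (hm H G A)
      ((2 * (H - A * t ^ 2) * (-A) + G ^ 2) / (2 * hm H G A (t ^ 2))) (t ^ 2) := hd0.sqrt hin
  have hd2 : HasDerivAt (fun τ => (hm H G A τ + (H - A * τ)) / 2)
      (((2 * (H - A * t ^ 2) * (-A) + G ^ 2) / (2 * hm H G A (t ^ 2)) - A) / 2) (t ^ 2) := by
    have h1 : HasDerivAt (fun τ : ℝ => H - A * τ) (-A) (t ^ 2) := by
      simpa using ((hasDerivAt_id (t ^ 2)).const_mul A).const_sub H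
    exact ((hd1.add h1).div_const 2)
  have hd3 := hd2.sqrt (by positivity)
  refine hd3.congr_deriv ?_
  have hσ : 0 < √((hm H G A (t ^ 2) + (H - A * t ^ 2)) / 2) := Real.sqrt_pos.2 (by positivity)
  have hσ2 : √((hm H G A (t ^ 2) + (H - A * t ^ 2)) / 2) ^ 2
      = (hm H G A (t ^ 2) + (H - A * t ^ 2)) / 2 := Real.sq_sqrt (by positivity)
  have hprod : √((hm H G A (t ^ 2) - (H - A * t ^ 2)) / 2) *
      √((hm H G A (t ^ 2) + (H - A * t ^ 2)) / 2) = t * |G| / 2 := by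
    rw [← Real.sqrt_mul' _ (by positivity)]
    have h0 : (hm H G A (t ^ 2) - (H - A * t ^ 2)) / 2 * ((hm H G A (t ^ 2) + (H - A * t ^ 2)) / 2)
        = (t * |G| / 2) ^ 2 := by
      have : |G| ^ 2 = G ^ 2 := sq_abs G
      nlinarith
    rw [h0, Real.sqrt_sq (by positivity)]
  rw [qq]
  set m := hm H G A (t ^ 2)
  set σ := √((m + (H - A * t ^ 2)) / 2)
  set η := √((m - (H - A * t ^ 2)) / 2)
  have hGG : |G| * |G| = G ^ 2 := by rw [abs_mul_abs_self]; ring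
  have key : (|G| * η - 2 * A * t * σ) * σ = t * (G ^ 2 / 2 - A * (m + (H - A * t ^ 2))) := by
    linear_combination |G| * hprod + t / 2 * hGG - 2 * A * t * hσ2
  have e1 : (|G| * η - 2 * A * t * σ) = t * (G ^ 2 / 2 - A * (m + (H - A * t ^ 2))) / σ := by
    rw [eq_div_iff hσ.ne', key]
  rw [e1]
  field_simp
  ring

lemma qq_nonneg (H G A : ℝ) (hA : A < 0) {t : ℝ} (ht : 0 ≤ t) : 0 ≤ qq H G A t := by
  unfold qq
  apply div_nonneg _ (hm_nonneg _ _ _ _)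
  have h1 : 0 ≤ -A * t * √((hm H G A (t ^ 2) + (H - A * t ^ 2)) / 2) := by
    have : 0 ≤ -A := by linarith
    positivity
  have h2 : 0 ≤ |G| * √((hm H G A (t ^ 2) - (H - A * t ^ 2)) / 2) := by positivity
  linarith

lemma qq_le (H G A : ℝ) (hA : A < 0) {t : ℝ} (ht : 0 < t) (hΔ : 0 ≤ G ^ 2 - 4 * A * H) :
    qq H G A t ≤ (|G| + 2 * |A| * t) / √(hm H G A (t ^ 2)) := by
  have hτ : 0 < t ^ 2 := by positivity
  have hmpos : 0 < hm H G A (t ^ 2) :=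
    lt_of_lt_of_le (by have := abs_pos.2 hA.ne; positivity) (hm_ge_A H G A hA hΔ hτ.le)
  have hb := abs_le.1 (abs_le_hm H G A hτ.le)
  unfold qq
  set m := hm H G A (t ^ 2)
  have h1 : √((m - (H - A * t ^ 2)) / 2) ≤ √m := Real.sqrt_le_sqrt (by linarith)
  have h2 : √((m + (H - A * t ^ 2)) / 2) ≤ √m := Real.sqrt_le_sqrt (by linarith)
  have h3 : (|G| + 2 * |A| * t) / √m = (|G| + 2 * |A| * t) * √m / m := by
    have hs : 0 < √m := Real.sqrt_pos.2 hmpos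
    rw [div_eq_div_iff hs.ne' hmpos.ne', mul_assoc _ (√m), Real.mul_self_sqrt hmpos.le]
  rw [h3]
  apply div_le_div_of_nonneg_right _ hmpos.le
  rw [abs_of_neg hA]
  have h4 := mul_le_mul_of_nonneg_left h1 (abs_nonneg G)
  have h5 := mul_le_mul_of_nonneg_left h2 (show 0 ≤ 2 * -A * t by
    have : 0 < -A := by linarith
    positivity)
  nlinarith

lemma qq_le_dom (H G A : ℝ) (hA : A < 0) {t : ℝ} (ht : 0 < t) (hΔ : 0 ≤ G ^ 2 - 4 * A * H)
    (hH : H ≠ 0) : qq H G A t ≤ |G| / √|H| + 2 * √|A| := by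
  refine (qq_le H G A hA ht hΔ).trans ?_
  have hτ : 0 < t ^ 2 := by positivity
  have hA' := abs_pos.2 hA.ne
  rw [add_div]
  have hH' : 0 < √|H| := Real.sqrt_pos.2 (abs_pos.2 hH)
  apply add_le_add
  · apply div_le_div_of_nonneg_left (abs_nonneg _) hH'
    exact Real.sqrt_le_sqrt (hm_ge_absH H G A hA hΔ hτ.le)
  · have h1 : √|A| * t ≤ √(hm H G A (t ^ 2)) := by
      have := Real.sqrt_le_sqrt (hm_ge_A H G A hA hΔ hτ.le)
      rwa [Real.sqrt_mul hA'.le, Real.sqrt_sq ht.le] at this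
    have hs := Real.sqrt_pos.2 hA'
    rw [div_le_iff₀ (lt_of_lt_of_le (by positivity) h1)]
    have h2 := Real.mul_self_sqrt hA'.le
    nlinarith

lemma qq_le_tail (H G A : ℝ) (hA : A < 0) {t : ℝ} (ht : 0 < t) (hΔ : 0 ≤ G ^ 2 - 4 * A * H) :
    qq H G A t ≤ |G| / (√|A| * t) + 2 * √|A| := by
  refine (qq_le H G A hA ht hΔ).trans ?_
  have hτ : 0 < t ^ 2 := by positivity
  have hA' := abs_pos.2 hA.ne
  rw [add_div]
  have hs := Real.sqrt_pos.2 hA'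
  have h1 : √|A| * t ≤ √(hm H G A (t ^ 2)) := by
    have := Real.sqrt_le_sqrt (hm_ge_A H G A hA hΔ hτ.le)
    rwa [Real.sqrt_mul hA'.le, Real.sqrt_sq ht.le] at this
  apply add_le_add
  · exact div_le_div_of_nonneg_left (abs_nonneg _) (by positivity) h1
  · rw [div_le_iff₀ (lt_of_lt_of_le (by positivity) h1)]
    have h2 := Real.mul_self_sqrt hA'.le
    nlinarith

lemma qq_tendsto (H G A : ℝ) (hH : H ≠ 0) :
    Tendsto (qq H G A) (𝓝[>] 0) (𝓝 (if H < 0 then |G| / √(-H) else 0)) := by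
  have hc : Continuous (fun t => hm H G A (t ^ 2)) := by unfold hm; fun_prop
  have h0 : hm H G A (0 ^ 2) = |H| := by simp [hm, Real.sqrt_sq_eq_abs]
  have hca : ContinuousAt (qq H G A) 0 := by
    unfold qq
    apply ContinuousAt.div
    · fun_prop
    · exact hc.continuousAt
    · rw [h0]; exact abs_ne_zero.2 hH
  have hv : qq H G A 0 = if H < 0 then |G| / √(-H) else 0 := by
    unfold qq
    rw [h0]
    split_ifs with h
    · rw [abs_of_neg h]
      have hs : 0 < √(-H) := Real.sqrt_pos.2 (by linarith)
      have : (-H - (H - A * 0 ^ 2)) / 2 = -H := by ring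
      rw [this, mul_zero, zero_mul, sub_zero, div_eq_div_iff (by linarith) hs.ne', mul_assoc,
        Real.mul_self_sqrt (by linarith)]
    · have hp : 0 < H := lt_of_le_of_ne (not_lt.1 h) (Ne.symm hH)
      rw [abs_of_pos hp]
      simp
  rw [← hv]
  exact hca.tendsto.mono_left nhdsWithin_le_nhds

end JZ
end

section
open Filter Topology MeasureTheory

namespace JZ

lemma sandwich_deriv (F : ℕ → ℝ → ℝ) (D : ℕ → ℝ) (φ : ℝ → ℝ) (φ' τ : ℝ) (hτ : 0 < τ)
    (hF : ∀ t s, 0 < t → 0 < s → Tendsto (fun n => F n t - F n s) atTop (𝓝 (φ t - φ s)))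
    (hD : HasDerivAt φ φ' τ)
    (h1 : ∀ n δ, 0 < δ → F n (τ + δ) - F n τ ≤ δ * D n)
    (h2 : ∀ n δ, 0 < δ → δ < τ → δ * D n ≤ F n τ - F n (τ - δ)) :
    Tendsto D atTop (𝓝 φ') := by
  rw [hasDerivAt_iff_tendsto_slope_zero] at hD
  have hr : Tendsto (fun δ => δ⁻¹ • (φ (τ + δ) - φ τ)) (𝓝[>] 0) (𝓝 φ') :=
    hD.mono_left (nhdsWithin_mono _ (fun x hx => ne_of_gt hx))
  have hl : Tendsto (fun δ => (-δ)⁻¹ • (φ (τ + -δ) - φ τ)) (𝓝[>] 0) (𝓝 φ') := by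
    apply hD.comp
    rw [tendsto_nhdsWithin_iff]
    constructor
    · have : Tendsto (fun δ : ℝ => -δ) (𝓝 0) (𝓝 (-0)) := tendsto_neg 0
      rw [neg_zero] at this
      exact this.mono_left nhdsWithin_le_nhds
    · filter_upwards [self_mem_nhdsWithin] with x hx
      have : (0:ℝ) < x := hx
      simp [this.ne']
  have hsmall : ∀ᶠ δ : ℝ in 𝓝[>] 0, 0 < δ ∧ δ < τ := by
    have : Set.Ioo 0 τ ∈ 𝓝[>] (0:ℝ) := Ioo_mem_nhdsGT hτ
    exact this
  rw [tendsto_order]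
  constructor
  · intro c hc
    obtain ⟨δ, ⟨hδ, hδ2⟩, hs⟩ := (hsmall.and (hr.eventually (lt_mem_nhds hc))).exists
    have := (hF (τ + δ) τ (by linarith) hτ).const_mul δ⁻¹
    filter_upwards [this.eventually (lt_mem_nhds hs)] with n hn
    refine hn.trans_le ?_
    rw [inv_mul_le_iff₀ hδ]
    exact h1 n δ hδ
  · intro c hc
    obtain ⟨δ, ⟨hδ, hδ2⟩, hs⟩ := (hsmall.and (hl.eventually (gt_mem_nhds hc))).exists
    have := (hF τ (τ - δ) hτ (by linarith)).const_mul δ⁻¹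
    have hs' : δ⁻¹ * (φ τ - φ (τ - δ)) < c := by
      have e : (-δ)⁻¹ • (φ (τ + -δ) - φ τ) = δ⁻¹ * (φ τ - φ (τ - δ)) := by
        rw [inv_neg, smul_eq_mul, ← sub_eq_add_neg]; ring
      rwa [e] at hs
    filter_upwards [this.eventually (gt_mem_nhds hs')] with n hn
    refine lt_of_le_of_lt ?_ hn
    rw [le_inv_mul_iff₀ hδ]
    exact h2 n δ hδ hδ2

lemma log_diff_le {u v : ℝ} (hu : 0 < u) (hv : 0 < v) : Real.log v - Real.log u ≤ (v - u) / u := by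
  rw [← Real.log_div hv.ne' hu.ne']
  refine (Real.log_le_sub_one_of_pos (by positivity)).trans (le_of_eq ?_)
  field_simp

/-- Convergence of Poisson sums from convergence of logarithmic sums. -/
lemma poisson_conv (Z : ℕ → Finset ℝ) (ρ : ℕ → ℝ) (hρ : ∀ n, 0 < ρ n)
    (H G A κ x : ℝ) (hA : A < 0) (hΔ : 0 ≤ G ^ 2 - 4 * A * H)
    (hlog : ∀ t s, 0 < t → 0 < s → Tendsto (fun n => (ρ n)⁻¹ * ∑ y ∈ Z n,
      (Real.log ((x - y) ^ 2 + t) - Real.log ((x - y) ^ 2 + s))) atTop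
        (𝓝 (4 * κ * (sg H G A t - sg H G A s)))) {t : ℝ} (ht : 0 < t) :
    Tendsto (fun n => (ρ n)⁻¹ * ∑ y ∈ Z n, t * ((x - y) ^ 2 + t ^ 2)⁻¹) atTop
      (𝓝 (κ * qq H G A t)) := by
  have hd := (hasDerivAt_sg H G A hA hΔ ht).const_mul (4 * κ)
  have key := sandwich_deriv (fun n s => (ρ n)⁻¹ * ∑ y ∈ Z n, Real.log ((x - y) ^ 2 + s))
    (fun n => (ρ n)⁻¹ * ∑ y ∈ Z n, ((x - y) ^ 2 + t ^ 2)⁻¹) _ _ (t ^ 2) (by positivity) ?_ hd ?_ ?_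
  · have := key.const_mul t
    have e : t * (4 * κ * (qq H G A t / (4 * t))) = κ * qq H G A t := by field_simp
    rw [e] at this
    refine this.congr (fun n => ?_)
    rw [← Finset.mul_sum]; ring
  · intro t s ht hs
    have := hlog t s ht hs
    simp only [Finset.sum_sub_distrib, mul_sub] at this ⊢
    exact this
  · intro n δ hδ
    rw [← mul_sub, ← Finset.sum_sub_distrib, mul_left_comm, Finset.mul_sum _ _ δ]
    apply mul_le_mul_of_nonneg_left _ (inv_pos.2 (hρ n)).le
    apply Finset.sum_le_sum
    intro y _
    refine (log_diff_le (by positivity) (by positivity)).trans (le_of_eq ?_)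
    rw [div_eq_mul_inv]; ring_nf
  · intro n δ hδ hδ2
    rw [← mul_sub, ← Finset.sum_sub_distrib, mul_left_comm, Finset.mul_sum _ _ δ]
    apply mul_le_mul_of_nonneg_left _ (inv_pos.2 (hρ n)).le
    apply Finset.sum_le_sum
    intro y _
    have h1 : 0 < (x - y) ^ 2 + t ^ 2 := by positivity
    have h2 : 0 < (x - y) ^ 2 + (t ^ 2 - δ) := by have := sq_nonneg (x - y); linarith
    have := log_diff_le h1 h2
    have e : ((x - y) ^ 2 + (t ^ 2 - δ) - ((x - y) ^ 2 + t ^ 2)) / ((x - y) ^ 2 + t ^ 2)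
      = - (δ * ((x - y) ^ 2 + t ^ 2)⁻¹) := by rw [div_eq_mul_inv]; ring
    rw [e] at this
    linarith

lemma ker_integral (y : ℝ) {s : ℝ} (hs : 0 < s) :
    Integrable (fun x : ℝ => s * ((x - y) ^ 2 + s ^ 2)⁻¹) ∧
    ∫ x : ℝ, s * ((x - y) ^ 2 + s ^ 2)⁻¹ = Real.pi := by
  have e : (fun x : ℝ => s * ((x - y) ^ 2 + s ^ 2)⁻¹) =
      fun x => s⁻¹ * (fun u : ℝ => (1 + u ^ 2)⁻¹) ((x - y) * s⁻¹) := by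
    funext x
    field_simp
    ring
  rw [e]
  have hi : Integrable (fun u : ℝ => (1 + (u * s⁻¹) ^ 2)⁻¹) :=
    integrable_inv_one_add_sq.comp_mul_right' (inv_pos.2 hs).ne'
  constructor
  · exact (hi.comp_sub_right y).const_mul _
  · rw [integral_const_mul]
    rw [integral_sub_right_eq_self (fun u : ℝ => (fun u : ℝ => (1 + u ^ 2)⁻¹) (u * s⁻¹)) y]
    rw [Measure.integral_comp_mul_right (fun u : ℝ => (1 + u ^ 2)⁻¹) s⁻¹, integral_univ_inv_one_add_sq]
    simp [abs_of_pos hs]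
    field_simp

/-- Poisson smoothing of a compactly supported function converges in the weighted norm. -/
lemma smooth_approx (f : ℝ → ℝ) (hf : Continuous f) (M Cf : ℝ) (hM : 1 ≤ M)
    (hsupp : ∀ x, M < |x| → f x = 0) (hCf : ∀ x, |f x| ≤ Cf) (η : ℝ) (hη : 0 < η) :
    ∀ᶠ s in 𝓝[>] (0:ℝ), ∀ y : ℝ,
      (1 + y ^ 2) * |Real.pi⁻¹ * (∫ x, f x * (s * ((x - y) ^ 2 + s ^ 2)⁻¹)) - f y| ≤ η := by
  have hCf0 : 0 ≤ Cf := (abs_nonneg _).trans (hCf 0)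
  have hcs : HasCompactSupport f := by
    apply HasCompactSupport.of_support_subset_isCompact (isCompact_Icc (a := -M) (b := M))
    intro x hx
    by_contra hcon
    apply hx
    apply hsupp
    by_contra h
    exact hcon (abs_le.1 (not_lt.1 h))
  have huc := hcs.uniformContinuous_of_continuous hf
  rw [Metric.uniformContinuous_iff] at huc
  set η' := η / (2 * (1 + 4 * M ^ 2)) with hη'
  have hη'pos : 0 < η' := by positivity
  obtain ⟨δ, hδ, hu⟩ := huc η' hη'pos
  set K := 2 * Cf * (1 + 1 / δ ^ 2) with hK
  have hK0 : 0 ≤ K := by positivity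
  have ev1 : ∀ᶠ s in 𝓝[>] (0:ℝ), 0 < s := self_mem_nhdsWithin
  have ev2 : ∀ᶠ s in 𝓝[>] (0:ℝ), (1 + 4 * M ^ 2) * (K * s) < η / 2 := by
    have : Tendsto (fun s : ℝ => (1 + 4 * M ^ 2) * (K * s)) (𝓝 0) (𝓝 ((1 + 4 * M ^ 2) * (K * 0))) := by
      apply Continuous.tendsto; fun_prop
    simp only [mul_zero] at this
    exact (this.mono_left nhdsWithin_le_nhds).eventually (gt_mem_nhds (by positivity))
  have ev3 : ∀ᶠ s in 𝓝[>] (0:ℝ), Real.pi⁻¹ * (16 * M * Cf * s) < η := by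
    have : Tendsto (fun s : ℝ => Real.pi⁻¹ * (16 * M * Cf * s)) (𝓝 0)
        (𝓝 (Real.pi⁻¹ * (16 * M * Cf * 0))) := by
      apply Continuous.tendsto; fun_prop
    simp only [mul_zero] at this
    exact (this.mono_left nhdsWithin_le_nhds).eventually (gt_mem_nhds (by positivity))
  filter_upwards [ev1, ev2, ev3] with s hs h2 h3 y
  obtain ⟨ki, kv⟩ := ker_integral y hs
  obtain ⟨ki1, kv1⟩ := ker_integral y one_pos
  have hfi : Integrable (fun x => f x * (s * ((x - y) ^ 2 + s ^ 2)⁻¹)) :=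
    ki.bdd_mul (c := Cf) hf.aestronglyMeasurable (Eventually.of_forall hCf)
  have hpi := Real.pi_pos
  rcases le_or_gt |y| (2 * M) with hy | hy
  · have e1 : Real.pi⁻¹ * (∫ x, f x * (s * ((x - y) ^ 2 + s ^ 2)⁻¹)) - f y
        = Real.pi⁻¹ * ∫ x, (f x - f y) * (s * ((x - y) ^ 2 + s ^ 2)⁻¹) := by
      simp only [sub_mul]
      rw [integral_sub hfi (ki.const_mul _), integral_const_mul, kv, mul_sub]
      congr 1
      field_simp
    have hb : |∫ x, (f x - f y) * (s * ((x - y) ^ 2 + s ^ 2)⁻¹)| ≤ η' * Real.pi + K * s * Real.pi := by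
      have hbi : Integrable (fun x : ℝ => η' * (s * ((x - y) ^ 2 + s ^ 2)⁻¹)
          + K * s * (1 * ((x - y) ^ 2 + 1 ^ 2)⁻¹)) := (ki.const_mul _).add (ki1.const_mul _)
      have := norm_integral_le_of_norm_le (f := fun x => (f x - f y) * (s * ((x - y) ^ 2 + s ^ 2)⁻¹)) hbi (Eventually.of_forall fun x => ?_)
      · rw [integral_add (ki.const_mul _) (ki1.const_mul _), integral_const_mul η', kv,
          integral_const_mul (K * s), kv1] at this
        exact this
      · rw [Real.norm_eq_abs, abs_mul, abs_of_pos (show 0 < s * ((x - y) ^ 2 + s ^ 2)⁻¹ by positivity)]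
        rcases lt_or_ge (dist x y) δ with hd | hd
        · have h4 := hu hd
          rw [Real.dist_eq] at h4
          have h5 : |f x - f y| * (s * ((x - y) ^ 2 + s ^ 2)⁻¹) ≤ η' * (s * ((x - y) ^ 2 + s ^ 2)⁻¹) :=
            mul_le_mul_of_nonneg_right h4.le (by positivity)
          have h6 : 0 ≤ K * s * (1 * ((x - y) ^ 2 + 1 ^ 2)⁻¹) := by positivity
          linarith
        · rw [Real.dist_eq] at hd
          have hd2 : δ ^ 2 ≤ (x - y) ^ 2 := by
            rw [← sq_abs (x - y)]; exact pow_le_pow_left₀ hδ.le hd 2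
          have hpos : 0 < (x - y) ^ 2 := lt_of_lt_of_le (by positivity) hd2
          have h4 : |f x - f y| ≤ 2 * Cf := by
            have := abs_sub (f x) (f y)
            linarith [hCf x, hCf y]
          have h5 : ((x - y) ^ 2 + s ^ 2)⁻¹ ≤ (1 + 1 / δ ^ 2) * ((x - y) ^ 2 + 1 ^ 2)⁻¹ := by
            rw [← div_eq_mul_inv, le_div_iff₀ (by positivity), inv_mul_le_iff₀ (by positivity)]
            have : 1 ≤ (x - y) ^ 2 * (1 / δ ^ 2) := by
              rw [mul_one_div, le_div_iff₀ (by positivity)]; linarith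
            nlinarith [show 0 ≤ s ^ 2 * (1 + 1 / δ ^ 2) by positivity]
          have h6 : 0 ≤ η' * (s * ((x - y) ^ 2 + s ^ 2)⁻¹) := by positivity
          calc |f x - f y| * (s * ((x - y) ^ 2 + s ^ 2)⁻¹)
              ≤ (2 * Cf) * (s * ((1 + 1 / δ ^ 2) * ((x - y) ^ 2 + 1 ^ 2)⁻¹)) := by gcongr
            _ = K * s * (1 * ((x - y) ^ 2 + 1 ^ 2)⁻¹) := by rw [hK]; ring
            _ ≤ _ := by linarith
    rw [e1, abs_mul, abs_of_pos (inv_pos.2 hpi)]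
    have h7 : Real.pi⁻¹ * |∫ x, (f x - f y) * (s * ((x - y) ^ 2 + s ^ 2)⁻¹)| ≤ η' + K * s := by
      rw [inv_mul_le_iff₀ hpi]; linarith
    have h8 : 1 + y ^ 2 ≤ 1 + 4 * M ^ 2 := by
      have : y ^ 2 ≤ (2 * M) ^ 2 := by rw [← sq_abs y]; exact pow_le_pow_left₀ (abs_nonneg _) hy 2
      nlinarith
    calc _ ≤ (1 + 4 * M ^ 2) * (η' + K * s) := by gcongr
      _ = η / 2 + (1 + 4 * M ^ 2) * (K * s) := by rw [hη']; field_simp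
      _ ≤ η := by linarith
  · have hfy : f y = 0 := hsupp y (by linarith)
    rw [hfy, sub_zero, abs_mul, abs_of_pos (inv_pos.2 hpi)]
    have hy0 : 0 < y ^ 2 := by rw [← sq_abs]; have : 0 < |y| := by linarith
                               positivity
    have hb : |∫ x, f x * (s * ((x - y) ^ 2 + s ^ 2)⁻¹)| ≤ 2 * M * (Cf * (s * (4 / y ^ 2))) := by
      have hbi : Integrable ((Set.Icc (-M) M).indicator (fun _ : ℝ => Cf * (s * (4 / y ^ 2)))) := by
        rw [integrable_indicator_iff measurableSet_Icc]
        exact integrableOn_const (by simp)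
      have := norm_integral_le_of_norm_le (f := fun x => f x * (s * ((x - y) ^ 2 + s ^ 2)⁻¹)) hbi (Eventually.of_forall fun x => ?_)
      · rw [integral_indicator measurableSet_Icc, setIntegral_const] at this
        simp only [Real.volume_real_Icc, smul_eq_mul] at this
        rw [max_eq_left (by linarith)] at this
        refine this.trans (le_of_eq (by ring))
      · by_cases hx : x ∈ Set.Icc (-M) M
        · rw [Set.indicator_of_mem hx, Real.norm_eq_abs, abs_mul,
            abs_of_pos (show 0 < s * ((x - y) ^ 2 + s ^ 2)⁻¹ by positivity)]
          have h4 : ((x - y) ^ 2 + s ^ 2)⁻¹ ≤ 4 / y ^ 2 := by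
            have hx' : |x| ≤ M := abs_le.2 hx
            have h5 : |y| / 2 ≤ |x - y| := by
              have := abs_sub_abs_le_abs_sub y x
              rw [abs_sub_comm] at this
              linarith
            have h6 : (|y| / 2) ^ 2 ≤ |x - y| ^ 2 := pow_le_pow_left₀ (by positivity) h5 2
            rw [sq_abs, div_pow, sq_abs] at h6
            have : (4 / y ^ 2) = (y ^ 2 / 4)⁻¹ := by rw [inv_div]
            rw [this]
            apply inv_anti₀ (by positivity)
            nlinarith [sq_nonneg s]
          have := hCf x
          gcongr
        · rw [Set.indicator_of_notMem hx]
          have : f x = 0 := hsupp x (by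
            by_contra h
            exact hx (abs_le.1 (not_lt.1 h)))
          simp [this]
    have hy1 : 1 ≤ y ^ 2 := by
      rw [← sq_abs]; have : 1 ≤ |y| := by linarith
      exact one_le_pow₀ this
    calc _ ≤ (1 + y ^ 2) * (Real.pi⁻¹ * (2 * M * (Cf * (s * (4 / y ^ 2))))) := by gcongr
      _ = ((1 + y ^ 2) / y ^ 2) * (Real.pi⁻¹ * (8 * M * Cf * s)) := by field_simp; ring
      _ ≤ 2 * (Real.pi⁻¹ * (8 * M * Cf * s)) := by
        gcongr
        rw [div_le_iff₀ hy0]; linarith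
      _ = Real.pi⁻¹ * (16 * M * Cf * s) := by ring
      _ ≤ η := h3.le

end JZ
end

section
open Filter Topology MeasureTheory

namespace JZ

lemma exists_psi : ∃ ψ : ℝ → ℝ, Integrable ψ ∧ (∀ u, 0 ≤ ψ u) ∧ ∀ u, (√|u|)⁻¹ ≤ 1 + ψ u := by
  set φ : ℝ → ℝ := (Set.Ioo (0:ℝ) 1).indicator (fun r => r ^ (-(1/2) : ℝ)) with hφ
  have hφ0 : ∀ r, 0 ≤ φ r := by
    intro r
    apply Set.indicator_nonneg
    intro x hx
    exact Real.rpow_nonneg hx.1.le _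
  have hφi : Integrable φ := by
    rw [hφ, integrable_indicator_iff measurableSet_Ioo]
    rw [intervalIntegral.integrableOn_Ioo_rpow_iff one_pos]
    norm_num
  refine ⟨fun u => φ u + φ (-u), hφi.add hφi.comp_neg, fun u => add_nonneg (hφ0 _) (hφ0 _),
    fun u => ?_⟩
  have h1 := hφ0 u
  have h2 := hφ0 (-u)
  rcases lt_or_ge |u| 1 with h | h
  · rcases eq_or_ne u 0 with h0 | h0
    · subst h0
      simp only [abs_zero, Real.sqrt_zero, inv_zero]
      linarith
    · have hm : |u| ∈ Set.Ioo (0:ℝ) 1 := ⟨abs_pos.2 h0, h⟩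
      have h3 : (√|u|)⁻¹ = φ |u| := by
        simp only [hφ, Set.indicator_of_mem hm]
        rw [Real.rpow_neg (abs_nonneg _), ← Real.sqrt_eq_rpow]
      rcases abs_choice u with h4 | h4 <;> rw [h3, h4] <;> linarith
  · have : (√|u|)⁻¹ ≤ 1 := inv_le_one_of_one_le₀ (Real.one_le_sqrt.2 h)
    linarith

lemma exists_dom (A B C : ℝ) (hA : A < 0) (hΔ : 0 ≤ B ^ 2 - 4 * A * C) :
    ∃ (K : ℝ) (E : ℝ → ℝ), 0 ≤ K ∧ Integrable E ∧ (∀ x, 0 ≤ E x) ∧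
      ∀ x, |2 * A * x + B| / √|A * x ^ 2 + B * x + C| + 2 * √|A| ≤ K + E x := by
  have hA' : 0 < |A| := abs_pos.2 hA.ne
  set D := B ^ 2 - 4 * A * C with hD
  have step1 : ∀ x, |2 * A * x + B| / √|A * x ^ 2 + B * x + C| ≤
      2 * √|A| + √D / √|A * x ^ 2 + B * x + C| := by
    intro x
    set H := A * x ^ 2 + B * x + C with hH
    rcases eq_or_ne H 0 with h0 | h0
    · simp [h0]
    have hs : 0 < √|H| := Real.sqrt_pos.2 (abs_pos.2 h0)
    rw [div_le_iff₀ hs, add_mul, div_mul_cancel₀ _ hs.ne']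
    apply abs_le_of_sq_le_sq _ (by positivity)
    have e1 : √|A| ^ 2 = -A := by rw [Real.sq_sqrt hA'.le, abs_of_neg hA]
    have e2 : √|H| ^ 2 = |H| := Real.sq_sqrt (abs_nonneg _)
    have e3 : √D ^ 2 = D := Real.sq_sqrt hΔ
    have e4 : (2 * A * x + B) ^ 2 = 4 * A * H + D := by rw [hH, hD]; ring
    have e5 : (2 * √|A| * √|H| + √D) ^ 2 = 4 * (-A) * |H| + D + 4 * √|A| * √|H| * √D := by
      linear_combination 4 * √|A| ^ 2 * e2 + 4 * |H| * e1 + e3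
    rw [e4, e5]
    have : 0 ≤ 4 * √|A| * √|H| * √D := by positivity
    nlinarith [neg_abs_le H]
  rcases hΔ.eq_or_lt with h0 | hpos
  · refine ⟨4 * √|A|, fun _ => 0, by positivity, integrable_zero _ _ _, fun _ => le_rfl, fun x => ?_⟩
    have := step1 x
    rw [← h0] at this
    simp only [Real.sqrt_zero, zero_div] at this
    linarith
  · obtain ⟨ψ, hψi, hψ0, hψ⟩ := exists_psi
    have hsD : 0 < √D := Real.sqrt_pos.2 hpos
    set x1 := (-B + √D) / (2 * A) with hx1
    set x2 := (-B - √D) / (2 * A) with hx2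
    set g := √D / |A| with hg
    have hgpos : 0 < g := by positivity
    have hgap : |x1 - x2| = g := by
      rw [hx1, hx2, hg, ← sub_div, abs_div, abs_mul]
      have : -B + √D - (-B - √D) = 2 * √D := by ring
      rw [this, abs_mul, abs_of_pos hsD]
      simp
      field_simp
    have hfac : ∀ x, A * x ^ 2 + B * x + C = A * ((x - x1) * (x - x2)) := by
      intro x
      have e3 : √D ^ 2 = B ^ 2 - 4 * A * C := Real.sq_sqrt hΔ
      have hA0 := hA.ne
      rw [hx1, hx2]
      field_simp
      linear_combination e3
    set K1 := √D * (√|A|)⁻¹ * (√(g / 2))⁻¹ with hK1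
    have hK1' : 0 ≤ K1 := by positivity
    refine ⟨4 * √|A| + 2 * K1, fun x => K1 * (ψ (x - x1) + ψ (x - x2)), by positivity,
      ((hψi.comp_sub_right x1).add (hψi.comp_sub_right x2)).const_mul _,
      fun x => mul_nonneg hK1' (add_nonneg (hψ0 _) (hψ0 _)), fun x => ?_⟩
    have h1 := step1 x
    have h2 : √D / √|A * x ^ 2 + B * x + C| ≤ K1 * ((√|x - x1|)⁻¹ + (√|x - x2|)⁻¹) := by
      rw [hfac, abs_mul, abs_mul, Real.sqrt_mul (abs_nonneg _), Real.sqrt_mul (abs_nonneg _),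
        div_eq_mul_inv, mul_inv, mul_inv, hK1, mul_assoc, mul_assoc]
      refine mul_le_mul_of_nonneg_left (mul_le_mul_of_nonneg_left ?_ (by positivity)) hsD.le
      have hor : g / 2 ≤ |x - x1| ∨ g / 2 ≤ |x - x2| := by
        by_contra hcon
        push Not at hcon
        have := abs_sub_le x1 x x2
        rw [abs_sub_comm x1 x] at this
        linarith
      have hgs : 0 < √(g / 2) := Real.sqrt_pos.2 (by positivity)
      rcases hor with h | h
      · have : (√|x - x1|)⁻¹ ≤ (√(g / 2))⁻¹ := inv_anti₀ hgs (Real.sqrt_le_sqrt h)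
        rw [mul_add]
        have h5 : 0 ≤ (√(g / 2))⁻¹ * (√|x - x1|)⁻¹ := by positivity
        have h6 := mul_le_mul_of_nonneg_right this (show 0 ≤ (√|x - x2|)⁻¹ by positivity)
        linarith
      · have : (√|x - x2|)⁻¹ ≤ (√(g / 2))⁻¹ := inv_anti₀ hgs (Real.sqrt_le_sqrt h)
        rw [mul_add]
        have h5 : 0 ≤ (√(g / 2))⁻¹ * (√|x - x2|)⁻¹ := by positivity
        have h6 := mul_le_mul_of_nonneg_left this (show 0 ≤ (√|x - x1|)⁻¹ by positivity)
        linarith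
    have h3 := hψ (x - x1)
    have h4 := hψ (x - x2)
    have h5 := mul_le_mul_of_nonneg_left (add_le_add h3 h4) hK1'
    linarith

end JZ
end

section
open Filter Topology MeasureTheory

namespace JZ

noncomputable def dens (A B C x : ℝ) : ℝ :=
  if A * x ^ 2 + B * x + C < 0 then |2 * A * x + B| / √(-(A * x ^ 2 + B * x + C)) else 0

noncomputable def qx (A B C t x : ℝ) : ℝ := qq (A * x ^ 2 + B * x + C) (2 * A * x + B) A t

lemma disc_x (A B C x : ℝ) : (2 * A * x + B) ^ 2 - 4 * A * (A * x ^ 2 + B * x + C)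
    = B ^ 2 - 4 * A * C := by ring

lemma ae_ne (A B C : ℝ) (hA : A < 0) : ∀ᵐ x : ℝ, A * x ^ 2 + B * x + C ≠ 0 := by
  have hfin : {x : ℝ | A * x ^ 2 + B * x + C = 0}.Finite := by
    apply Set.Finite.subset (s := {(-B + √(B ^ 2 - 4 * A * C)) / (2 * A),
      (-B - √(B ^ 2 - 4 * A * C)) / (2 * A)}) (by simp)
    intro x hx
    have hx : A * x ^ 2 + B * x + C = 0 := hx
    have h1 := disc_x A B C x
    rw [hx, mul_zero, sub_zero] at h1
    have hA0 := hA.ne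
    have h2 : |2 * A * x + B| = √(B ^ 2 - 4 * A * C) := by rw [← h1, Real.sqrt_sq_eq_abs]
    simp only [Set.mem_insert_iff, Set.mem_singleton_iff]
    rw [eq_div_iff (by simpa using hA0), eq_div_iff (by simpa using hA0), ← h2]
    rcases abs_choice (2 * A * x + B) with h | h <;> rw [h]
    · left; ring
    · right; ring
  rw [ae_iff]
  simp only [ne_eq, not_not]
  exact hfin.measure_zero _

lemma qx_cont (A B C : ℝ) (hA : A < 0) (hΔ : 0 ≤ B ^ 2 - 4 * A * C) {t : ℝ} (ht : 0 < t) :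
    Continuous (qx A B C t) := by
  unfold qx qq
  have hc : Continuous fun x => hm (A * x ^ 2 + B * x + C) (2 * A * x + B) A (t ^ 2) := by
    unfold hm; fun_prop
  apply Continuous.div (by fun_prop) hc
  intro x
  have := hm_ge_A (A * x ^ 2 + B * x + C) (2 * A * x + B) A hA (by rw [disc_x]; exact hΔ) (sq_nonneg t)
  have h2 := abs_pos.2 hA.ne
  have : 0 < |A| * t ^ 2 := by positivity
  linarith


lemma mass_bound (A B C κ : ℝ)
    (Z : ℕ → Finset ℝ) (ρ : ℕ → ℝ)
    (hP : ∀ x t, 0 < t → Tendsto (fun n => (ρ n)⁻¹ * ∑ y ∈ Z n, t * ((x - y) ^ 2 + t ^ 2)⁻¹) atTop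
      (𝓝 (κ * qx A B C t x)))
    : ∃ C0, 0 ≤ C0 ∧ ∀ n, (ρ n)⁻¹ * ∑ y ∈ Z n, (1 + y ^ 2)⁻¹ ≤ C0 := by
  obtain ⟨c, hc⟩ := (hP 0 1 one_pos).bddAbove_range
  refine ⟨max c 0, le_max_right _ _, fun n => le_trans (le_of_eq ?_) (le_trans (hc ⟨n, rfl⟩) (le_max_left _ _))⟩
  simp [add_comm]

lemma I_bound (Z : ℕ → Finset ℝ) (ρ : ℕ → ℝ)
    (hρ : ∀ n, 0 < ρ n)
    (C0 : ℝ) (h0 : ∀ n, (ρ n)⁻¹ * ∑ y ∈ Z n, (1 + y ^ 2)⁻¹ ≤ C0)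
    (g : ℝ → ℝ) (η : ℝ) (hη : 0 ≤ η) (hg : ∀ y, (1 + y ^ 2) * |g y| ≤ η) (n : ℕ) :
    |(ρ n)⁻¹ * ∑ y ∈ Z n, g y| ≤ C0 * η := by
  rw [abs_mul, abs_of_pos (inv_pos.2 (hρ n))]
  calc (ρ n)⁻¹ * |∑ y ∈ Z n, g y| ≤ (ρ n)⁻¹ * ∑ y ∈ Z n, η * (1 + y ^ 2)⁻¹ := by
        apply mul_le_mul_of_nonneg_left _ (inv_pos.2 (hρ n)).le
        refine (Finset.abs_sum_le_sum_abs _ _).trans (Finset.sum_le_sum fun y _ => ?_)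
        rw [← div_eq_mul_inv, le_div_iff₀ (by positivity), mul_comm]
        exact hg y
    _ = ((ρ n)⁻¹ * ∑ y ∈ Z n, (1 + y ^ 2)⁻¹) * η := by rw [← Finset.mul_sum]; ring
    _ ≤ C0 * η := mul_le_mul_of_nonneg_right (h0 n) hη

lemma dens_dom (A B C : ℝ)
    (K : ℝ) (E : ℝ → ℝ) (hK : 0 ≤ K) (hE0 : ∀ x, 0 ≤ E x)
    (hE : ∀ x, |2 * A * x + B| / √|A * x ^ 2 + B * x + C| + 2 * √|A| ≤ K + E x) (x : ℝ) :
    |dens A B C x| ≤ K + E x := by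
  unfold dens
  split_ifs with h
  · rw [abs_of_nonneg (by positivity), ← abs_of_neg h]
    have := hE x
    have : 0 ≤ 2 * √|A| := by positivity
    linarith
  · simp; linarith [hE0 x]

lemma dens_meas (A B C : ℝ)
    : Measurable (dens A B C) := by
  unfold dens
  refine Measurable.ite ?_ (by fun_prop) (by fun_prop)
  exact measurableSet_lt (by fun_prop) (by fun_prop)

lemma dens_integrable (A B C : ℝ)
    (hA : A < 0) (hΔ : 0 ≤ B ^ 2 - 4 * A * C)
    (f : ℝ → ℝ) (hf : Continuous f) (Cf : ℝ)
    (hCf : ∀ x, (1 + x ^ 2) * |f x| ≤ Cf) : Integrable (fun x => f x * dens A B C x) := by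
  obtain ⟨K, E, hK, hEi, hE0, hE⟩ := exists_dom A B C hA hΔ
  have hCf0 : 0 ≤ Cf := le_trans (by positivity) (hCf 0)
  have hb : Integrable (fun x => Cf * K * (1 + x ^ 2)⁻¹ + Cf * E x) :=
    (integrable_inv_one_add_sq.const_mul _).add (hEi.const_mul _)
  refine hb.mono' (hf.measurable.mul (dens_meas A B C)).aestronglyMeasurable
    (Eventually.of_forall fun x => ?_)
  have h1 := dens_dom A B C K E hK hE0 hE x
  rw [Real.norm_eq_abs, abs_mul]
  have h2 : |f x| ≤ Cf * (1 + x ^ 2)⁻¹ := by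
    rw [← div_eq_mul_inv, le_div_iff₀ (by positivity), mul_comm]; exact hCf x
  have h3 : (1 + x ^ 2)⁻¹ ≤ 1 := inv_le_one_of_one_le₀ (by nlinarith [sq_nonneg x])
  calc |f x| * |dens A B C x| ≤ (Cf * (1 + x ^ 2)⁻¹) * (K + E x) := by gcongr
    _ = Cf * K * (1 + x ^ 2)⁻¹ + Cf * E x * (1 + x ^ 2)⁻¹ := by ring
    _ ≤ Cf * K * (1 + x ^ 2)⁻¹ + Cf * E x * 1 := by
      have := hE0 x
      gcongr
    _ = _ := by ring

lemma qx_to_dens (A B C : ℝ)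
    (hA : A < 0) (hΔ : 0 ≤ B ^ 2 - 4 * A * C)
    (f : ℝ → ℝ) (hf : Continuous f) (Cf : ℝ)
    (hCf : ∀ x, (1 + x ^ 2) * |f x| ≤ Cf) :
    Tendsto (fun s => ∫ x, f x * qx A B C s x) (𝓝[>] 0) (𝓝 (∫ x, f x * dens A B C x)) := by
  obtain ⟨K, E, hK, hEi, hE0, hE⟩ := exists_dom A B C hA hΔ
  have hCf0 : 0 ≤ Cf := le_trans (by positivity) (hCf 0)
  have hb : Integrable (fun x => Cf * K * (1 + x ^ 2)⁻¹ + Cf * E x) :=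
    (integrable_inv_one_add_sq.const_mul _).add (hEi.const_mul _)
  apply tendsto_integral_filter_of_dominated_convergence _ _ _ hb
  · filter_upwards [ae_ne A B C hA] with x hx
    exact (qq_tendsto _ _ A hx).const_mul (f x)
  · filter_upwards [self_mem_nhdsWithin] with s hs
    exact (hf.mul (qx_cont A B C hA hΔ hs)).aestronglyMeasurable
  · filter_upwards [self_mem_nhdsWithin] with s hs
    have hs : 0 < s := hs
    filter_upwards [ae_ne A B C hA] with x hx
    have h1 : |qx A B C s x| ≤ K + E x := by
      rw [abs_of_nonneg (show 0 ≤ qx A B C s x from qq_nonneg _ _ A hA hs.le)]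
      exact (qq_le_dom _ _ A hA hs (by rw [disc_x]; exact hΔ) hx).trans (hE x)
    rw [Real.norm_eq_abs, abs_mul]
    have h2 : |f x| ≤ Cf * (1 + x ^ 2)⁻¹ := by
      rw [← div_eq_mul_inv, le_div_iff₀ (by positivity), mul_comm]; exact hCf x
    have h3 : (1 + x ^ 2)⁻¹ ≤ 1 := inv_le_one_of_one_le₀ (by nlinarith [sq_nonneg x])
    calc |f x| * |qx A B C s x| ≤ (Cf * (1 + x ^ 2)⁻¹) * (K + E x) := by gcongr
      _ = Cf * K * (1 + x ^ 2)⁻¹ + Cf * E x * (1 + x ^ 2)⁻¹ := by ring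
      _ ≤ Cf * K * (1 + x ^ 2)⁻¹ + Cf * E x * 1 := by
        have := hE0 x
        gcongr
      _ = _ := by ring

lemma smoothed_conv (A B C κ : ℝ)
    (hA : A < 0) (hΔ : 0 ≤ B ^ 2 - 4 * A * C)
    (Z : ℕ → Finset ℝ) (ρ : ℕ → ℝ)
    (hρ : ∀ n, 0 < ρ n)
    (hP : ∀ x t, 0 < t → Tendsto (fun n => (ρ n)⁻¹ * ∑ y ∈ Z n, t * ((x - y) ^ 2 + t ^ 2)⁻¹) atTop
      (𝓝 (κ * qx A B C t x)))
    (f : ℝ → ℝ) (hf : Continuous f) (hcs : HasCompactSupport f) {s : ℝ} (hs : 0 < s) :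
    Tendsto (fun n => (ρ n)⁻¹ * ∑ y ∈ Z n, (Real.pi⁻¹ * ∫ x, f x * (s * ((x - y) ^ 2 + s ^ 2)⁻¹)))
      atTop (𝓝 (Real.pi⁻¹ * (κ * ∫ x, f x * qx A B C s x))) := by
  obtain ⟨C0, hC0, h0⟩ := mass_bound A B C κ Z ρ hP
  have hIntg : ∀ y : ℝ, Integrable (fun x => f x * (s * ((x - y) ^ 2 + s ^ 2)⁻¹)) := by
    intro y
    have hc : Continuous (fun x => f x * (s * ((x - y) ^ 2 + s ^ 2)⁻¹)) := by
      have : ∀ x : ℝ, (x - y) ^ 2 + s ^ 2 ≠ 0 := fun x => by positivity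
      fun_prop (disch := assumption)
    exact hc.integrable_of_hasCompactSupport hcs.mul_right
  have e : ∀ n, (ρ n)⁻¹ * ∑ y ∈ Z n, (Real.pi⁻¹ * ∫ x, f x * (s * ((x - y) ^ 2 + s ^ 2)⁻¹))
      = Real.pi⁻¹ * ∫ x, f x * ((ρ n)⁻¹ * ∑ y ∈ Z n, s * ((x - y) ^ 2 + s ^ 2)⁻¹) := by
    intro n
    rw [← Finset.mul_sum, ← integral_finsetSum _ (fun y _ => hIntg y), mul_left_comm,
      ← integral_const_mul]
    congr 2
    funext x
    rw [← Finset.mul_sum]; ring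
  simp_rw [e]
  apply Tendsto.const_mul
  rw [← integral_const_mul]
  set L := s * (1 + 1 / s ^ 2) * 2 * C0
  have hb : Integrable (fun x => |f x| * (L * (1 + x ^ 2))) := by
    have hc : Continuous (fun x => |f x| * (L * (1 + x ^ 2))) := by fun_prop
    exact hc.integrable_of_hasCompactSupport (HasCompactSupport.mul_right (hcs.comp_left abs_zero))
  apply tendsto_integral_of_dominated_convergence _ _ hb
  · intro n
    refine Eventually.of_forall fun x => ?_
    rw [Real.norm_eq_abs, abs_mul]
    apply mul_le_mul_of_nonneg_left _ (abs_nonneg _)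
    have := I_bound Z ρ hρ C0 h0 (fun y => s * ((x - y) ^ 2 + s ^ 2)⁻¹)
      (s * (1 + 1 / s ^ 2) * 2 * (1 + x ^ 2)) (by positivity) (fun y => ?_) n
    · refine this.trans (le_of_eq ?_)
      simp only [L]; ring
    · rw [abs_of_pos (by positivity), mul_left_comm, mul_assoc, mul_assoc]
      apply mul_le_mul_of_nonneg_left _ hs.le
      rw [← div_eq_mul_inv, div_le_iff₀ (by positivity)]
      have h1 : 1 + y ^ 2 ≤ 2 * (1 + x ^ 2) * (1 + (x - y) ^ 2) := by
        nlinarith [sq_nonneg (x - y), sq_nonneg x, sq_nonneg (2 * x - y), mul_nonneg (sq_nonneg x) (sq_nonneg (x - y))]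
      have h2 : 1 + (x - y) ^ 2 ≤ (1 + 1 / s ^ 2) * ((x - y) ^ 2 + s ^ 2) := by
        have : (1 + 1 / s ^ 2) * ((x - y) ^ 2 + s ^ 2) = (x - y) ^ 2 + s ^ 2 + (x - y) ^ 2 / s ^ 2 + 1 := by
          field_simp
          ring
        rw [this]
        have : 0 ≤ (x - y) ^ 2 / s ^ 2 := by positivity
        nlinarith [sq_nonneg s]
      calc _ ≤ 2 * (1 + x ^ 2) * (1 + (x - y) ^ 2) := h1
        _ ≤ 2 * (1 + x ^ 2) * ((1 + 1 / s ^ 2) * ((x - y) ^ 2 + s ^ 2)) := by gcongr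
        _ = _ := by ring
  · refine Eventually.of_forall fun x => ?_
    have := (hP x s hs).const_mul (f x)
    rw [mul_left_comm] at this
    exact this
  · intro n
    have : ∀ x y : ℝ, (x - y) ^ 2 + s ^ 2 ≠ 0 := fun x y => by positivity
    apply Continuous.aestronglyMeasurable
    apply hf.mul
    apply continuous_const.mul
    apply continuous_finsetSum
    intro y _
    have h := fun x => this x y
    fun_prop (disch := assumption)

lemma cc_conv (A B C κ : ℝ)
    (hA : A < 0) (hΔ : 0 ≤ B ^ 2 - 4 * A * C)
    (Z : ℕ → Finset ℝ) (ρ : ℕ → ℝ)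
    (hρ : ∀ n, 0 < ρ n)
    (hP : ∀ x t, 0 < t → Tendsto (fun n => (ρ n)⁻¹ * ∑ y ∈ Z n, t * ((x - y) ^ 2 + t ^ 2)⁻¹) atTop
      (𝓝 (κ * qx A B C t x)))
    (f : ℝ → ℝ) (hf : Continuous f) (M : ℝ) (hM : 1 ≤ M)
    (hsupp : ∀ x, M < |x| → f x = 0) :
    Tendsto (fun n => (ρ n)⁻¹ * ∑ y ∈ Z n, f y) atTop
      (𝓝 (Real.pi⁻¹ * (κ * ∫ x, f x * dens A B C x))) := by
  obtain ⟨C0, hC0, h0⟩ := mass_bound A B C κ Z ρ hP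
  have hcs : HasCompactSupport f := by
    apply HasCompactSupport.of_support_subset_isCompact (isCompact_Icc (a := -M) (b := M))
    intro x hx
    by_contra hcon
    apply hx
    apply hsupp
    by_contra h
    exact hcon (abs_le.1 (not_lt.1 h))
  obtain ⟨Cf, hCf⟩ := hcs.exists_bound_of_continuous hf
  have hcs2 : HasCompactSupport (fun x => (1 + x ^ 2) * f x) := hcs.mul_left
  obtain ⟨Cf2, hCf2⟩ := hcs2.exists_bound_of_continuous (by fun_prop)
  have hCf2' : ∀ x, (1 + x ^ 2) * |f x| ≤ Cf2 := by
    intro x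
    have := hCf2 x
    rwa [Real.norm_eq_abs, abs_mul, abs_of_pos (by positivity)] at this
  have hq := ((qx_to_dens A B C hA hΔ f hf Cf2 hCf2').const_mul κ).const_mul Real.pi⁻¹
  rw [Metric.tendsto_atTop]
  intro e he
  have hsm := smooth_approx f hf M Cf hM hsupp hCf (e / (3 * (C0 + 1))) (by positivity)
  have hq' := (Metric.tendsto_nhds.1 hq) (e / 3) (by positivity)
  obtain ⟨s, ⟨h1, h2⟩, hs⟩ := ((hsm.and hq').and self_mem_nhdsWithin).exists
  have hs : 0 < s := hs
  obtain ⟨n0, hn0⟩ := Metric.tendsto_atTop.1 (smoothed_conv A B C κ hA hΔ Z ρ hρ hP f hf hcs hs) (e / 3) (by positivity)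
  refine ⟨n0, fun n hn => ?_⟩
  have h3 := hn0 n hn
  have h4 := I_bound Z ρ hρ C0 h0 _ _ (by positivity) h1 n
  rw [Finset.sum_sub_distrib, mul_sub] at h4
  rw [Real.dist_eq] at *
  have h5 : C0 * (e / (3 * (C0 + 1))) ≤ e / 3 := by
    rw [mul_div_assoc', div_le_div_iff₀ (by positivity) (by positivity)]
    nlinarith
  have h4' := h4.trans h5
  rw [abs_lt] at *
  rw [abs_le] at h4'
  constructor <;> linarith [h4'.1, h4'.2, h2.1, h2.2, h3.1, h3.2]

lemma tail_bound (A B C κ : ℝ)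
    (hA : A < 0) (hΔ : 0 ≤ B ^ 2 - 4 * A * C)
    (Z : ℕ → Finset ℝ) (ρ : ℕ → ℝ)
    (hρ : ∀ n, 0 < ρ n)
    (hP : ∀ x t, 0 < t → Tendsto (fun n => (ρ n)⁻¹ * ∑ y ∈ Z n, t * ((x - y) ^ 2 + t ^ 2)⁻¹) atTop
      (𝓝 (κ * qx A B C t x)))
    (hκ : 0 ≤ κ) : ∃ L, 0 ≤ L ∧ ∀ T : ℝ, 1 ≤ T → ∀ᶠ n in atTop,
    (ρ n)⁻¹ * ∑ y ∈ Z n, (y ^ 2 + T ^ 2)⁻¹ ≤ L / T := by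
  have hA' := abs_pos.2 hA.ne
  set L0 := |B| / √|A| + 2 * √|A| with hL0
  have hL0' : 0 ≤ L0 := by positivity
  refine ⟨κ * L0 + 1, by positivity, fun T hT => ?_⟩
  have hT0 : 0 < T := by linarith
  have h1 := hP 0 T hT0
  have h2 : qx A B C T 0 ≤ L0 := by
    refine (qq_le_tail _ _ A hA hT0 (by rw [disc_x]; exact hΔ)).trans ?_
    rw [hL0, mul_zero, zero_add]
    gcongr
    have : 0 < √|A| := Real.sqrt_pos.2 hA'
    nlinarith
  have h3 : κ * qx A B C T 0 < κ * L0 + 1 := by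
    have := mul_le_mul_of_nonneg_left h2 hκ
    linarith
  filter_upwards [h1.eventually (gt_mem_nhds h3)] with n hn
  rw [le_div_iff₀ hT0]
  refine le_trans (le_of_eq ?_) hn.le
  rw [← Finset.mul_sum]
  simp
  ring

theorem analysis_main (A B C κ : ℝ)
    (hA : A < 0) (hΔ : 0 ≤ B ^ 2 - 4 * A * C)
    (Z : ℕ → Finset ℝ) (ρ : ℕ → ℝ)
    (hρ : ∀ n, 0 < ρ n)
    (hP : ∀ x t, 0 < t → Tendsto (fun n => (ρ n)⁻¹ * ∑ y ∈ Z n, t * ((x - y) ^ 2 + t ^ 2)⁻¹) atTop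
      (𝓝 (κ * qx A B C t x)))
    (hκ : 0 ≤ κ) (f : ℝ → ℝ) (hf : Continuous f) (Cf : ℝ)
    (hCf : ∀ x, (1 + x ^ 2) * |f x| ≤ Cf) :
    Tendsto (fun n => (ρ n)⁻¹ * ∑ y ∈ Z n, f y) atTop
      (𝓝 (Real.pi⁻¹ * (κ * ∫ x, f x * dens A B C x))) := by
  have hCf0 : 0 ≤ Cf := le_trans (by positivity) (hCf 0)
  obtain ⟨L, hL0, hL⟩ := tail_bound A B C κ hA hΔ Z ρ hρ hP hκ
  set χ : ℝ → ℝ → ℝ := fun M x => max 0 (min 1 (M + 1 - |x|)) with hχ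
  have χ0 : ∀ M x, 0 ≤ χ M x := fun M x => le_max_left _ _
  have χ1 : ∀ M x, χ M x ≤ 1 := fun M x => max_le zero_le_one (min_le_left _ _)
  have χin : ∀ M x, |x| ≤ M → χ M x = 1 := by
    intro M x h
    simp only [hχ]
    rw [min_eq_left (by linarith), max_eq_right zero_le_one]
  have χout : ∀ M x, M + 1 < |x| → χ M x = 0 := by
    intro M x h
    simp only [hχ]
    exact max_eq_left ((min_le_right _ _).trans (by linarith))
  have χc : ∀ M, Continuous (χ M) := fun M => by simp only [hχ]; fun_prop
  have hcut : ∀ M, 1 ≤ M → Tendsto (fun n => (ρ n)⁻¹ * ∑ y ∈ Z n, f y * χ M y) atTop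
      (𝓝 (Real.pi⁻¹ * (κ * ∫ x, (f x * χ M x) * dens A B C x))) := by
    intro M hM
    exact cc_conv A B C κ hA hΔ Z ρ hρ hP (fun x => f x * χ M x) (hf.mul (χc M)) (M + 1)
      (by linarith) (fun x hx => by rw [χout M x hx, mul_zero])
  have hlim : Tendsto (fun M => ∫ x, (f x * χ M x) * dens A B C x) atTop
      (𝓝 (∫ x, f x * dens A B C x)) := by
    apply tendsto_integral_filter_of_dominated_convergence _ _ _
      (dens_integrable A B C hA hΔ f hf Cf hCf).norm
    · refine Eventually.of_forall fun x => ?_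
      apply tendsto_const_nhds.congr'
      filter_upwards [eventually_ge_atTop |x|] with M hM
      rw [χin M x hM, mul_one]
    · exact Eventually.of_forall fun M =>
        ((hf.mul (χc M)).measurable.mul (dens_meas A B C)).aestronglyMeasurable
    · refine Eventually.of_forall fun M => Eventually.of_forall fun x => ?_
      rw [norm_mul, norm_mul, norm_mul]
      apply mul_le_mul_of_nonneg_right _ (norm_nonneg _)
      rw [Real.norm_eq_abs (χ M x), abs_of_nonneg (χ0 M x)]
      exact mul_le_of_le_one_right (norm_nonneg _) (χ1 M x)
  have hlim' := (hlim.const_mul κ).const_mul Real.pi⁻¹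
  rw [Metric.tendsto_atTop]
  intro e he
  have ev1 := (Metric.tendsto_nhds.1 hlim') (e / 3) (by positivity)
  have ev2 : ∀ᶠ M : ℝ in atTop, Cf * 2 * (L / M) < e / 3 := by
    have : Tendsto (fun M : ℝ => Cf * 2 * (L / M)) atTop (𝓝 (Cf * 2 * 0)) :=
      (tendsto_const_nhds.div_atTop tendsto_id).const_mul _
    rw [mul_zero] at this
    exact this.eventually (gt_mem_nhds (by positivity))
  obtain ⟨M, ⟨h1, h2⟩, hM⟩ := ((ev1.and ev2).and (eventually_ge_atTop 1)).exists
  have ev3 := (Metric.tendsto_nhds.1 (hcut M hM)) (e / 3) (by positivity)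
  obtain ⟨n0, hn0⟩ := eventually_atTop.1 (ev3.and (hL M hM))
  refine ⟨n0, fun n hn => ?_⟩
  obtain ⟨h3, h4⟩ := hn0 n hn
  have h5 : |(ρ n)⁻¹ * ∑ y ∈ Z n, f y - (ρ n)⁻¹ * ∑ y ∈ Z n, f y * χ M y| ≤ Cf * 2 * (L / M) := by
    rw [← mul_sub, ← Finset.sum_sub_distrib, abs_mul, abs_of_pos (inv_pos.2 (hρ n))]
    calc (ρ n)⁻¹ * |∑ y ∈ Z n, (f y - f y * χ M y)|
        ≤ (ρ n)⁻¹ * ∑ y ∈ Z n, Cf * 2 * (y ^ 2 + M ^ 2)⁻¹ := by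
          apply mul_le_mul_of_nonneg_left _ (inv_pos.2 (hρ n)).le
          refine (Finset.abs_sum_le_sum_abs _ _).trans (Finset.sum_le_sum fun y _ => ?_)
          rcases le_or_gt |y| M with h | h
          · rw [χin M y h, mul_one, sub_self, abs_zero]; positivity
          · have e1 : f y - f y * χ M y = f y * (1 - χ M y) := by ring
            rw [e1, abs_mul, abs_of_nonneg (sub_nonneg.2 (χ1 M y))]
            have h6 : |f y| * (1 - χ M y) ≤ |f y| :=
              mul_le_of_le_one_right (abs_nonneg _) (by linarith [χ0 M y])
            refine h6.trans ?_
            rw [← div_eq_mul_inv, le_div_iff₀ (by positivity)]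
            have h7 := hCf y
            have h8 : M ^ 2 ≤ y ^ 2 := by
              rw [← sq_abs y]; exact pow_le_pow_left₀ (by linarith) h.le 2
            nlinarith [abs_nonneg (f y), mul_nonneg (abs_nonneg (f y)) (sub_nonneg.2 h8)]
      _ = Cf * 2 * ((ρ n)⁻¹ * ∑ y ∈ Z n, (y ^ 2 + M ^ 2)⁻¹) := by rw [← Finset.mul_sum]; ring
      _ ≤ _ := by gcongr
  have h5' := h5.trans h2.le
  rw [Real.dist_eq] at *
  rw [abs_lt] at *
  rw [abs_le] at h5'
  constructor <;> linarith [h5'.1, h5'.2, h1.1, h1.2, h3.1, h3.2]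


end JZ
end

section
open Filter Topology MeasureTheory
namespace JZ

lemma final_analysis (A B C κ : ℝ) (hA : A < 0) (hΔ : 0 ≤ B ^ 2 - 4 * A * C) (hκ : 0 ≤ κ)
    (Z : ℕ → Finset ℝ) (ρ : ℕ → ℝ) (hρ : ∀ n, 0 < ρ n)
    (hlog : ∀ x t s : ℝ, 0 < t → 0 < s → Tendsto (fun n => (ρ n)⁻¹ * ∑ y ∈ Z n,
      (Real.log ((x - y) ^ 2 + t) - Real.log ((x - y) ^ 2 + s))) atTop
      (𝓝 (4 * κ * (sg (A * x ^ 2 + B * x + C) (2 * A * x + B) A t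
        - sg (A * x ^ 2 + B * x + C) (2 * A * x + B) A s))))
    (f : ℝ → ℝ) (hf : Continuous f) (Cf : ℝ) (hCf : ∀ x, (1 + x ^ 2) * |f x| ≤ Cf) :
    Tendsto (fun n => (ρ n)⁻¹ * ∑ y ∈ Z n, f y) atTop
      (𝓝 (∫ x in {x : ℝ | A * x ^ 2 + B * x + C < 0}, f x * ((Real.pi⁻¹ * κ) *
        |2 * A * x + B| / √(-(A * x ^ 2 + B * x + C))))) := by
  have hP : ∀ x t : ℝ, 0 < t → Tendsto (fun n => (ρ n)⁻¹ * ∑ y ∈ Z n, t * ((x - y) ^ 2 + t ^ 2)⁻¹)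
      atTop (𝓝 (κ * qx A B C t x)) := by
    intro x t ht
    exact poisson_conv Z ρ hρ _ _ A κ x hA (by rw [disc_x]; exact hΔ)
      (fun t s ht hs => hlog x t s ht hs) ht
  have := analysis_main A B C κ hA hΔ Z ρ hρ hP hκ f hf Cf hCf
  convert this using 2
  have hm : MeasurableSet {x : ℝ | A * x ^ 2 + B * x + C < 0} :=
    measurableSet_lt (by fun_prop) (by fun_prop)
  rw [← integral_indicator hm, ← integral_const_mul, ← integral_const_mul]
  congr 1
  funext x
  by_cases h : A * x ^ 2 + B * x + C < 0
  · rw [Set.indicator_of_mem (by exact h)]; simp only [dens, if_pos h]; ring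
  · rw [Set.indicator_of_notMem (by exact h)]; simp only [dens, if_neg h]; ring
end JZ
end

section
open Filter Topology
namespace JZ

lemma contraction_real (x g δ : ℕ → ℝ) (κ : ℝ) (hκ : 0 < κ) (hx : ∀ j, 0 ≤ x j)
    (hg : ∀ j, 0 < g j) (hg0 : Tendsto g atTop (𝓝 0))
    (hS : Tendsto (fun n => ∑ j ∈ Finset.range n, g j) atTop atTop)
    (hδ : Tendsto δ atTop (𝓝 0))
    (h : ∀ᶠ j in atTop, x (j + 1) ≤ (1 - κ * g j) * x j + g j * δ j) :
    Tendsto x atTop (𝓝 0) := by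
  rw [Metric.tendsto_atTop]
  intro e he
  set η := e / 2 with hη
  have hηp : 0 < η := by positivity
  have e1 : ∀ᶠ j in atTop, δ j < κ * η := hδ.eventually (gt_mem_nhds (by positivity))
  have e2 : ∀ᶠ j in atTop, g j < 1 / κ := hg0.eventually (gt_mem_nhds (by positivity))
  obtain ⟨J, hJ⟩ := eventually_atTop.1 (h.and (e1.and e2))
  have step : ∀ j ≥ J, max (x (j + 1) - η) 0 ≤ Real.exp (-(κ * g j)) * max (x j - η) 0 := by
    intro j hj
    obtain ⟨h1, h2, h3⟩ := hJ j hj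
    have hgj := hg j
    rw [lt_div_iff₀ hκ] at h3
    have h4 : 0 ≤ 1 - κ * g j := by linarith
    have h5 : 1 - κ * g j ≤ Real.exp (-(κ * g j)) := by
      linarith [Real.add_one_le_exp (-(κ * g j))]
    apply max_le
    · have : x (j + 1) - η ≤ (1 - κ * g j) * (x j - η) := by nlinarith
      refine this.trans ?_
      calc _ ≤ (1 - κ * g j) * max (x j - η) 0 := mul_le_mul_of_nonneg_left (le_max_left _ _) h4
        _ ≤ _ := mul_le_mul_of_nonneg_right h5 (le_max_right _ _)
    · positivity
  have bd : ∀ j ≥ J, max (x j - η) 0 ≤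
      Real.exp (-(κ * (∑ i ∈ Finset.range j, g i - ∑ i ∈ Finset.range J, g i))) * max (x J - η) 0 := by
    intro j hj
    induction j, hj using Nat.le_induction with
    | base => simp
    | succ j hj ih =>
      refine (step j hj).trans ?_
      calc _ ≤ Real.exp (-(κ * g j)) * _ := mul_le_mul_of_nonneg_left ih (Real.exp_pos _).le
        _ = _ := by
          rw [← mul_assoc, ← Real.exp_add, Finset.sum_range_succ]
          congr 2; ring
  have lim : Tendsto (fun j => Real.exp (-(κ * (∑ i ∈ Finset.range j, g i - ∑ i ∈ Finset.range J, g i)))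
      * max (x J - η) 0) atTop (𝓝 (0 * max (x J - η) 0)) := by
    apply Tendsto.mul_const
    apply Real.tendsto_exp_neg_atTop_nhds_zero.comp
    exact (tendsto_atTop_add_const_right _ _ hS).const_mul_atTop hκ
  rw [zero_mul] at lim
  obtain ⟨J2, hJ2⟩ := eventually_atTop.1 (lim.eventually (gt_mem_nhds hηp))
  refine ⟨max J J2, fun j hj => ?_⟩
  have h1 := bd j (le_of_max_le_left hj)
  have h2 := hJ2 j (le_of_max_le_right hj)
  rw [Real.dist_eq, sub_zero, abs_of_nonneg (hx j)]
  have := le_max_left (x j - η) 0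
  linarith

lemma contraction (ζ q e : ℕ → ℂ) (g : ℕ → ℝ) (s : ℂ) (hs : 0 < s.re)
    (hg : ∀ j, 0 < g j) (hg0 : Tendsto g atTop (𝓝 0))
    (hS : Tendsto (fun n => ∑ j ∈ Finset.range n, g j) atTop atTop)
    (hq : Tendsto q atTop (𝓝 s)) (he : Tendsto e atTop (𝓝 0))
    (h : ∀ᶠ j in atTop, ζ (j + 1) = (1 - g j * q j) * ζ j + g j * e j) :
    Tendsto ζ atTop (𝓝 0) := by
  rw [tendsto_zero_iff_norm_tendsto_zero]
  apply contraction_real _ g (fun j => ‖e j‖) (s.re / 2) (by positivity) (fun j => norm_nonneg _) hg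
    hg0 hS (by simpa using he.norm)
  have e1 : ∀ᶠ j in atTop, g j * ‖q j‖ ^ 2 < 2 * (q j).re - s.re := by
    have l1 : Tendsto (fun j => g j * ‖q j‖ ^ 2) atTop (𝓝 (0 * ‖s‖ ^ 2)) := hg0.mul (hq.norm.pow 2)
    have l2 : Tendsto (fun j => 2 * (q j).re - s.re) atTop (𝓝 (2 * s.re - s.re)) :=
      (((Complex.continuous_re.tendsto s).comp hq).const_mul 2).sub_const _
    exact l1.eventually_lt l2 (by linarith)
  have e2 : ∀ᶠ j in atTop, g j < 1 / (s.re / 2) := hg0.eventually (gt_mem_nhds (by positivity))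
  filter_upwards [h, e1, e2] with j h1 h2 h3
  rw [lt_div_iff₀ (by positivity)] at h3
  rw [h1]
  refine (norm_add_le _ _).trans ?_
  have hgj := hg j
  rw [norm_mul, norm_mul, Complex.norm_of_nonneg hgj.le]
  gcongr
  apply le_of_sq_le_sq _ (by linarith)
  rw [← Complex.normSq_eq_norm_sq, Complex.normSq_apply]
  rw [← Complex.normSq_eq_norm_sq, Complex.normSq_apply] at h2
  simp only [Complex.sub_re, Complex.one_re, Complex.re_ofReal_mul, Complex.sub_im, Complex.one_im, Complex.im_ofReal_mul]
  nlinarith [mul_lt_mul_of_pos_left h2 hgj, sq_nonneg (s.re / 2 * g j)]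

/-- log growth -/
lemma log_growth (c l : ℕ → ℂ) (g : ℕ → ℝ) (L : ℂ) (ε : ℝ) (hε : |ε| = 1)
    (hg : ∀ j, 0 < g j) (hg0 : Tendsto g atTop (𝓝 0))
    (hS : Tendsto (fun n => ∑ j ∈ Finset.range n, g j) atTop atTop)
    (hl : Tendsto l atTop (𝓝 L)) (hc : ∀ j, c j ≠ 0)
    (h : ∀ j, c (j + 1) = ε * (c j * (1 + g j * l j))) :
    Tendsto (fun n => Real.log ‖c n‖ / ∑ j ∈ Finset.range n, g j) atTop (𝓝 L.re) := by
  have hu0 : Tendsto (fun j => (g j : ℂ) * l j) atTop (𝓝 0) := by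
    have : Tendsto (fun j => (g j : ℂ)) atTop (𝓝 ((0:ℝ):ℂ)) :=
      (Complex.continuous_ofReal.tendsto _).comp hg0
    simpa using this.mul hl
  have hd : ∀ j, Real.log ‖c (j + 1)‖ - Real.log ‖c j‖ = Real.log ‖1 + g j * l j‖ := by
    intro j
    have h1 : ‖c (j + 1)‖ = ‖c j‖ * ‖1 + g j * l j‖ := by
      rw [h j, norm_mul, norm_mul, Complex.norm_real, Real.norm_eq_abs, hε, one_mul]
    have h2 : ‖1 + (g j : ℂ) * l j‖ ≠ 0 := by
      intro h0
      rw [h0, mul_zero] at h1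
      exact hc (j + 1) (norm_eq_zero.1 h1)
    rw [h1, Real.log_mul (norm_ne_zero_iff.2 (hc j)) h2]; ring
  have ho : (fun j => Real.log ‖1 + (g j : ℂ) * l j‖ - g j * L.re) =o[atTop] g := by
    have hb : ∀ᶠ j in atTop, ‖(Real.log ‖1 + (g j : ℂ) * l j‖ - g j * L.re)‖ ≤
        ‖g j * (g j * ‖l j‖ ^ 2 + ‖l j - L‖)‖ := by
      have : ∀ᶠ j in atTop, ‖(g j : ℂ) * l j‖ < 1 / 2 := by
        have := hu0.norm
        rw [norm_zero] at this
        exact this.eventually (gt_mem_nhds (by norm_num))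
      filter_upwards [this] with j hj
      have hgj := hg j
      set u := (g j : ℂ) * l j with hu
      have h1 : Real.log ‖1 + u‖ = (Complex.log (1 + u)).re := (Complex.log_re _).symm
      have h2 := Complex.norm_log_one_add_sub_self_le (z := u) (by linarith)
      have h3 : |(Complex.log (1 + u) - u).re| ≤ ‖u‖ ^ 2 := by
        refine (Complex.abs_re_le_norm _).trans (h2.trans ?_)
        have : (1 - ‖u‖)⁻¹ ≤ 2 := by
          rw [inv_le_comm₀ (by linarith) (by norm_num)]; linarith
        nlinarith [sq_nonneg ‖u‖]
      have h4 : |(u - g j * L).re| ≤ g j * ‖l j - L‖ := by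
        refine (Complex.abs_re_le_norm _).trans ?_
        rw [hu, ← mul_sub, norm_mul, Complex.norm_of_nonneg hgj.le]
      have h5 : ‖u‖ ^ 2 = g j * (g j * ‖l j‖ ^ 2) := by
        rw [hu, norm_mul, Complex.norm_of_nonneg hgj.le]; ring
      have h6 : (g j * L).re = g j * L.re := Complex.re_ofReal_mul _ _
      rw [Real.norm_eq_abs, Real.norm_eq_abs, abs_of_nonneg (a := g j * _) (by positivity), h1]
      have h7 : (Complex.log (1 + u)).re - g j * L.re
        = (Complex.log (1 + u) - u).re + (u - g j * L).re := by
        simp only [Complex.sub_re, h6]; ring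
      rw [h7]
      refine (abs_add_le _ _).trans ?_
      rw [mul_add]; linarith
    refine (Asymptotics.IsBigO.of_bound (g := fun j => g j * (g j * ‖l j‖ ^ 2 + ‖l j - L‖)) 1
      (by simpa only [one_mul] using hb)).trans_isLittleO ?_
    have l1 : Tendsto (fun j => g j * ‖l j‖ ^ 2 + ‖l j - L‖) atTop (𝓝 (0 * ‖L‖ ^ 2 + ‖L - L‖)) :=
      (hg0.mul (hl.norm.pow 2)).add (hl.sub_const L).norm
    have : (fun j => g j * ‖l j‖ ^ 2 + ‖l j - L‖) =o[atTop] (fun _ => (1:ℝ)) := by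
      rw [Asymptotics.isLittleO_one_iff]; simpa using l1
    simpa using (Asymptotics.isBigO_refl g atTop).mul_isLittleO this
  have hsum := ho.sum_range (fun j => (hg j).le) hS
  have e1 : ∀ n, ∑ j ∈ Finset.range n, (Real.log ‖1 + (g j : ℂ) * l j‖ - g j * L.re)
      = Real.log ‖c n‖ - Real.log ‖c 0‖ - (∑ j ∈ Finset.range n, g j) * L.re := by
    intro n
    rw [Finset.sum_sub_distrib, ← Finset.sum_mul]
    simp_rw [← hd]
    rw [Finset.sum_range_sub (fun j => Real.log ‖c j‖)]
  simp_rw [e1] at hsum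
  have t1 := hsum.tendsto_div_nhds_zero
  have t2 : Tendsto (fun n => Real.log ‖c 0‖ / ∑ j ∈ Finset.range n, g j) atTop (𝓝 0) :=
    tendsto_const_nhds.div_atTop hS
  have t3 := (t1.add t2).add_const L.re
  rw [zero_add, zero_add] at t3
  apply t3.congr'
  filter_upwards [hS.eventually_gt_atTop 0] with n hn
  field_simp
  ring

end JZ
end

section
open Filter Topology
namespace JZ

lemma tendsto_bdd_mul {u v : ℕ → ℂ} {M : ℝ} (hu : ∀ j, ‖u j‖ ≤ M) (hv : Tendsto v atTop (𝓝 0)) :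
    Tendsto (fun j => v j * u j) atTop (𝓝 0) := by
  apply squeeze_zero_norm (a := fun j => ‖v j‖ * M)
  · intro j; rw [norm_mul]; exact mul_le_mul_of_nonneg_left (hu j) (norm_nonneg _)
  · simpa using hv.norm.mul_const M

lemma dynamics (v1 v2 x11 x12 x21 x22 : ℕ → ℂ) (g : ℕ → ℝ) (ε : ℝ) (hε : |ε| = 1)
    (hg : ∀ j, 0 < g j) (hg0 : Tendsto g atTop (𝓝 0))
    (hS : Tendsto (fun n => ∑ j ∈ Finset.range n, g j) atTop atTop)
    (r11 r12 r21 r22 lp lm mp mm : ℂ)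
    (h11 : Tendsto x11 atTop (𝓝 r11)) (h12 : Tendsto x12 atTop (𝓝 r12))
    (h21 : Tendsto x21 atTop (𝓝 r21)) (h22 : Tendsto x22 atTop (𝓝 r22))
    (hv : ∀ j, v1 j ≠ 0) (hw : ∀ j, 0 ≤ (v2 j / v1 j).im)
    (hv1 : ∀ j, v1 (j + 1) = ε * (v1 j + g j * (x11 j * v1 j + x12 j * v2 j)))
    (hv2 : ∀ j, v2 (j + 1) = ε * (v2 j + g j * (x21 j * v1 j + x22 j * v2 j)))
    (hmm : mm.im < 0) (hl : lm.re < lp.re)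
    (k1 : r21 - mm * r11 = - lp * mm) (k2 : r22 - mm * r12 = lp)
    (k3 : r21 - mp * r11 = - lm * mp) (k4 : r22 - mp * r12 = lm)
    (k5 : r11 + r12 * mp = lp) :
    Tendsto (fun j => v2 j / v1 j) atTop (𝓝 mp) ∧
    Tendsto (fun n => Real.log ‖v1 n‖ / ∑ j ∈ Finset.range n, g j) atTop (𝓝 lp.re) := by
  have hε0 : (ε : ℂ) ≠ 0 := by
    intro h; rw [Complex.ofReal_eq_zero] at h; rw [h] at hε; simp at hε
  set w : ℕ → ℂ := fun j => v2 j / v1 j with hwdef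
  have hwv : ∀ j, v2 j = w j * v1 j := fun j => by
    simp only [hwdef]; rw [div_mul_cancel₀ _ (hv j)]
  have him : ∀ j, -mm.im ≤ ‖w j - mm‖ := by
    intro j
    have := Complex.abs_im_le_norm (w j - mm)
    have h2 := le_abs_self (w j - mm).im
    rw [Complex.sub_im] at h2
    rw [Complex.sub_im] at this
    have := hw j
    simp only [hwdef] at *
    linarith
  have hwm : ∀ j, w j - mm ≠ 0 := fun j h => by
    have := him j; rw [h, norm_zero] at this; linarith
  have b1 : ∀ j, ‖(w j - mm)⁻¹‖ ≤ (-mm.im)⁻¹ := by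
    intro j
    rw [norm_inv]
    exact inv_anti₀ (by linarith) (him j)
  have b2 : ∀ j, ‖w j * (w j - mm)⁻¹‖ ≤ 1 + ‖mm‖ * (-mm.im)⁻¹ := by
    intro j
    have : w j * (w j - mm)⁻¹ = 1 + mm * (w j - mm)⁻¹ := by
      have := hwm j
      field_simp; ring
    rw [this]
    refine (norm_add_le _ _).trans ?_
    rw [norm_one, norm_mul]
    gcongr
    exact b1 j
  -- errors
  have y (m s1 s2 : ℂ) (hs1 : r21 - m * r11 = s1) (hs2 : r22 - m * r12 = s2) :
      Tendsto (fun j => (x21 j - m * x11 j - s1) * (w j - mm)⁻¹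
        + (x22 j - m * x12 j - s2) * (w j * (w j - mm)⁻¹)) atTop (𝓝 0) := by
    have l1 : Tendsto (fun j => x21 j - m * x11 j - s1) atTop (𝓝 0) := by
      have := (h21.sub (h11.const_mul m)).sub_const s1
      rwa [hs1, sub_self] at this
    have l2 : Tendsto (fun j => x22 j - m * x12 j - s2) atTop (𝓝 0) := by
      have := (h22.sub (h12.const_mul m)).sub_const s2
      rwa [hs2, sub_self] at this
    simpa using (tendsto_bdd_mul b1 l1).add (tendsto_bdd_mul b2 l2)
  set e : ℕ → ℂ := fun j => (x21 j - mm * x11 j - (-lp * mm)) * (w j - mm)⁻¹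
        + (x22 j - mm * x12 j - lp) * (w j * (w j - mm)⁻¹) with hedef
  set e' : ℕ → ℂ := fun j => (x21 j - mp * x11 j - (-lm * mp)) * (w j - mm)⁻¹
        + (x22 j - mp * x12 j - lm) * (w j * (w j - mm)⁻¹) with he'def
  have he : Tendsto e atTop (𝓝 0) := y mm _ _ k1 k2
  have he' : Tendsto e' atTop (𝓝 0) := y mp _ _ k3 k4
  have hgC : Tendsto (fun j => (g j : ℂ)) atTop (𝓝 0) := by
    have := (Complex.continuous_ofReal.tendsto _).comp hg0
    rw [Complex.ofReal_zero] at this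
    exact this
  set D : ℕ → ℂ := fun j => 1 + g j * (lp + e j) with hD
  have hDl : Tendsto D atTop (𝓝 1) := by
    have := (hgC.mul (he.const_add lp)).const_add 1
    simpa using this
  have hD0 : ∀ᶠ j in atTop, D j ≠ 0 := hDl.eventually_ne one_ne_zero
  set ζ : ℕ → ℂ := fun j => (w j - mp) * (w j - mm)⁻¹ with hζ
  have hζl : Tendsto ζ atTop (𝓝 0) := by
    apply contraction ζ (fun j => (lp + e j - lm) / D j) (fun j => e' j / D j) g (lp - lm)
      (by rw [Complex.sub_re]; linarith) hg hg0 hS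
    · have := ((he.const_add lp).sub_const lm).div hDl one_ne_zero
      rw [add_zero, div_one] at this
      exact this
    · have := he'.div hDl one_ne_zero
      rw [div_one] at this
      exact this
    · filter_upwards [hD0] with j hj
      have hn := hwm j
      -- c and d
      have hc : v2 (j + 1) - mm * v1 (j + 1) = ε * v1 j * (w j - mm) * D j := by
        rw [hv1, hv2, hwv j]; simp only [hD, hedef]; field_simp; ring
      have hd : v2 (j + 1) - mp * v1 (j + 1) = ε * v1 j * (w j - mm) *
          (ζ j * (1 + g j * lm) + g j * e' j) := by
        rw [hv1, hv2, hwv j]; simp only [hζ, he'def]; field_simp; ring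
      have hζ1 : ζ (j + 1) = (v2 (j + 1) - mp * v1 (j + 1)) / (v2 (j + 1) - mm * v1 (j + 1)) := by
        simp only [hζ]
        have h1 := hv (j + 1)
        have h2 := hwm (j + 1)
        have h3 : v2 (j + 1) - mm * v1 (j + 1) = (w (j + 1) - mm) * v1 (j + 1) := by
          rw [hwv]; ring
        have h4 : v2 (j + 1) - mp * v1 (j + 1) = (w (j + 1) - mp) * v1 (j + 1) := by
          rw [hwv]; ring
        rw [h3, h4]; field_simp
      have h1 := hv j
      rw [hζ1, hc, hd]
      have h5 : (1 - g j * ((lp + e j - lm) / D j)) = (1 + g j * lm) / D j := by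
        field_simp; simp only [hD]; ring
      rw [h5]
      field_simp
  have hpm : mp - mm ≠ 0 := by
    intro h
    have : mp = mm := sub_eq_zero.1 h
    rw [this] at k4
    rw [← k2, ← k4] at hl
    exact lt_irrefl _ hl
  have hwl : Tendsto w atTop (𝓝 mp) := by
    have h1 : ∀ j, w j = mm + (mp - mm) / (1 - ζ j) := by
      intro j
      have hn := hwm j
      have : 1 - ζ j = (mp - mm) / (w j - mm) := by
        simp only [hζ]; field_simp; ring
      rw [this]; field_simp; ring
    have := (((hζl.const_sub 1).inv₀ (by simp)).const_mul (mp - mm)).const_add mm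
    simp only [sub_zero, inv_one, mul_one, add_sub_cancel] at this
    refine this.congr fun j => ?_
    rw [h1 j, div_eq_mul_inv]
  refine ⟨hwl, ?_⟩
  have hL : Tendsto (fun j => x11 j + x12 j * w j) atTop (𝓝 lp) := by
    have := h11.add (h12.mul hwl)
    rwa [k5] at this
  apply log_growth v1 (fun j => x11 j + x12 j * w j) g lp ε hε hg hg0 hS hL hv
  intro j
  rw [hv1, hwv j]; ring

end JZ
end

section
open Filter Topology
namespace JZ

lemma sign_id (ra rb rc rd u v w : ℝ) (z l m : ℂ)
    (h1 : (ra - z * u) + (rb - z * w) * m = l) (h2 : (rc + z * v) + (rd + z * u) * m = l * m) :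
    m.im * (2 * l.re - (ra + rd)) = z.im * (v + 2 * u * m.re + w * (m.re ^ 2 + m.im ^ 2)) := by
  have e1 := congrArg Complex.re h1
  have e2 := congrArg Complex.im h1
  have e4 := congrArg Complex.im h2
  simp at e1 e2 e4
  rw [← e2, ← e1] at e4
  rw [← e1]
  linear_combination -e4

lemma form_pos (u v w p q : ℝ) (hw : 0 < w) (h : u ^ 2 < v * w) :
    0 < v + 2 * u * p + w * (p ^ 2 + q ^ 2) := by
  have : 0 < w * (v + 2 * u * p + w * (p ^ 2 + q ^ 2)) := by
    nlinarith [sq_nonneg (w * p + u), sq_nonneg (w * q)]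
  exact pos_of_mul_pos_right this hw.le |>.trans_le le_rfl

lemma eig (ra rb rc rd u v w x τ : ℝ) (hw : 0 < w) (huv : u ^ 2 < v * w)
    (hτ : 0 < τ) (A B C : ℝ) (hA : A = 4 * (u ^ 2 - v * w))
    (hB : B = -4 * u * (ra - rd) + 4 * (rb * v - w * rc))
    (hC : C = (ra - rd) ^ 2 + 4 * rb * rc) (z : ℂ) (hz : z = x + √τ * Complex.I) :
    ∃ lp lm mp mm : ℂ, 0 < mp.im ∧ mm.im < 0 ∧ lm.re < lp.re ∧
      2 * lp.re = (ra + rd) + sg (A * x ^ 2 + B * x + C) (2 * A * x + B) A τ ∧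
      (rc + z * v) - mm * (ra - z * u) = - lp * mm ∧ (rd + z * u) - mm * (rb - z * w) = lp ∧
      (rc + z * v) - mp * (ra - z * u) = - lm * mp ∧ (rd + z * u) - mp * (rb - z * w) = lm ∧
      (ra - z * u) + (rb - z * w) * mp = lp := by
  have hzi : z.im = √τ := by rw [hz]; simp
  have hzr : z.re = x := by rw [hz]; simp
  have hzp : 0 < z.im := by rw [hzi]; exact Real.sqrt_pos.2 hτ
  set h : ℂ := A * z ^ 2 + B * z + C with hh
  obtain ⟨s, hs, hs0⟩ : ∃ s : ℂ, s ^ 2 = h ∧ 0 ≤ s.re := by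
    obtain ⟨s, hs⟩ := IsAlgClosed.exists_pow_nat_eq h (n := 2) (by norm_num)
    rcases le_total 0 s.re with h0 | h0
    · exact ⟨s, hs, h0⟩
    · exact ⟨-s, by rw [neg_sq, hs], by simpa using h0⟩
  have hsre : s.re = sg (A * x ^ 2 + B * x + C) (2 * A * x + B) A τ := by
    have hr : h.re = (A * x ^ 2 + B * x + C) - A * τ := by
      rw [hh]; simp [pow_two, hzr, hzi, Real.mul_self_sqrt hτ.le]; ring
    have hi : h.im = √τ * (2 * A * x + B) := by
      rw [hh]; simp [pow_two, hzr, hzi]; ring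
    have hn : ‖h‖ = hm (A * x ^ 2 + B * x + C) (2 * A * x + B) A τ := by
      unfold hm
      rw [Complex.norm_def, Complex.normSq_apply, hr, hi]
      congr 1
      have := Real.mul_self_sqrt hτ.le
      linear_combination (2 * A * x + B) ^ 2 * this
    unfold sg
    rw [← hn, ← hr, eq_comm, Real.sqrt_eq_iff_mul_self_eq (by linarith [neg_abs_le h.re, Complex.abs_re_le_norm h]) hs0]
    rw [← hs, norm_pow, ← Complex.normSq_eq_norm_sq, Complex.normSq_apply]
    simp [pow_two]
  have hR12 : (rb : ℂ) - z * w ≠ 0 := by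
    intro h0
    have := congrArg Complex.im h0
    simp at this
    rcases this with h1 | h1 <;> linarith
  have hsq : s ^ 2 = (ra - rd - 2 * z * u) ^ 2 + 4 * (rb - z * w) * (rc + z * v) := by
    rw [hs, hh, hA, hB, hC]; push_cast; ring
  set lp : ℂ := ((ra + rd : ℝ) + s) / 2 with hlp
  set lm : ℂ := ((ra + rd : ℝ) - s) / 2 with hlm
  set mp : ℂ := (lp - (ra - z * u)) / (rb - z * w) with hmp
  set mm : ℂ := (lm - (ra - z * u)) / (rb - z * w) with hmm
  have hlpr : 2 * lp.re = (ra + rd) + s.re := by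
    rw [hlp]
    have : (((ra + rd : ℝ) + s) / 2 : ℂ).re = ((ra + rd) + s.re) / 2 := by
      have : (((ra + rd : ℝ) + s) / 2 : ℂ) = (((1/2 : ℝ)) : ℂ) * ((ra + rd : ℝ) + s) := by push_cast; ring
      rw [this, Complex.re_ofReal_mul, Complex.add_re, Complex.ofReal_re]; ring
    rw [this]; ring
  have hlmr : 2 * lm.re = (ra + rd) - s.re := by
    have : lp + lm = (ra + rd : ℝ) := by rw [hlp, hlm]; ring
    have := congrArg Complex.re this
    rw [Complex.add_re, Complex.ofReal_re] at this
    linarith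
  have p1 : (ra - z * u) + (rb - z * w) * mp = lp := by rw [hmp]; field_simp; ring
  have p2 : (ra - z * u) + (rb - z * w) * mm = lm := by rw [hmm]; field_simp; ring
  have p3 : (rc + z * v) + (rd + z * u) * mp = lp * mp := by
    rw [hmp, hlp]; field_simp; push_cast; linear_combination (-1 : ℂ) * hsq
  have p4 : (rc + z * v) + (rd + z * u) * mm = lm * mm := by
    rw [hmm, hlm]; field_simp; push_cast; linear_combination (-1 : ℂ) * hsq
  have i1 := sign_id ra rb rc rd u v w z lp mp p1 p3
  have i2 := sign_id ra rb rc rd u v w z lm mm p2 p4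
  have f1 := mul_pos hzp (form_pos u v w mp.re mp.im hw huv)
  have f2 := mul_pos hzp (form_pos u v w mm.re mm.im hw huv)
  rw [← i1, hlpr] at f1
  rw [← i2, hlmr] at f2
  have f1' : 0 < mp.im * s.re := by linarith
  have f2' : 0 < -mm.im * s.re := by linarith
  have hs1 : 0 < s.re := by
    rcases hs0.lt_or_eq with h | h
    · exact h
    · rw [← h] at f1'; simp at f1'
  have g1 : 0 < mp.im := pos_of_mul_pos_left f1' hs1.le
  have g2 : 0 < -mm.im := pos_of_mul_pos_left f2' hs1.le
  have hsum : lp + lm = ra + rd := by rw [hlp, hlm]; push_cast; ring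
  clear_value lp lm mp mm
  refine ⟨lp, lm, mp, mm, g1, by linarith, by linarith, by rw [hlpr, hsre], ?_, ?_, ?_, ?_, p1⟩
  · linear_combination p4 + mm * hsum
  · linear_combination -hsum - p2
  · linear_combination p3 + mp * hsum
  · linear_combination -hsum - p1

end JZ
end

section
open Filter Topology
namespace JZ

lemma per_nat {N : ℕ} {α : ℤ → ℝ} (h : ∀ k : ℤ, α (k + N) = α k) (j : ℕ) (k : ℤ) :
    α ((j : ℤ) * N + k) = α k := by
  induction j with
  | zero => simp
  | succ j ih =>
    rw [← ih, ← h (j * N + k)]; congr 1; push_cast; ring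

lemma per_bound {N : ℕ} (hN : 1 ≤ N) {α : ℤ → ℝ} (hpos : ∀ k, 0 < α k)
    (h : ∀ k : ℤ, α (k + N) = α k) : ∃ K : ℝ, 0 < K ∧ ∀ n : ℕ, α n ≤ K := by
  refine ⟨∑ k ∈ Finset.range N, α k, Finset.sum_pos (fun k _ => hpos _) ⟨0, Finset.mem_range.2 hN⟩, fun n => ?_⟩
  have e : α n = α ((n % N : ℕ) : ℤ) := by
    have := per_nat h (n / N) ((n % N : ℕ) : ℤ)
    rw [← this]
    congr 1
    have := Nat.div_add_mod' n N
    exact_mod_cast this.symm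
  rw [e]
  exact Finset.single_le_sum (f := fun k : ℕ => α k) (fun k _ => (hpos _).le)
    (Finset.mem_range.2 (Nat.mod_lt _ hN))

lemma memD1N_lim {N : ℕ} (hN : 1 ≤ N) {x : ℕ → ℝ} (h : MemD1N N x) (c : ℕ) :
    ∃ l, Tendsto (fun j => x (j * N + c)) atTop (𝓝 l) := by
  apply cauchySeq_tendsto_of_complete
  apply cauchySeq_of_summable_dist
  have hi : Function.Injective (fun j : ℕ => j * N + c) := by
    intro i j hij
    have : i * N = j * N := by simpa using hij
    exact Nat.eq_of_mul_eq_mul_right (by omega) this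
  refine (h.2.comp_injective hi).congr fun j => ?_
  simp only [Function.comp, Real.dist_eq]
  rw [abs_sub_comm]
  congr 3
  rw [Nat.succ_eq_add_one]; ring

lemma tendsto_jN {N : ℕ} (hN : 1 ≤ N) (c : ℕ) : Tendsto (fun j : ℕ => j * N + c) atTop atTop :=
  tendsto_atTop_mono (fun j => by
    have := Nat.mul_le_mul_left j hN
    simp only [id]; omega) tendsto_id

lemma ratio_lim {N : ℕ} (hN : 1 ≤ N)
    (a : ℕ → ℝ) (ha : ∀ n, 0 < a n) (α : ℤ → ℝ) (hαpos : ∀ k, 0 < α k)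
    (hαper : ∀ k : ℤ, α (k + N) = α k)
    (hmod2 : Tendsto (fun n : ℕ => a n / a (n + 1) - α n / α (n + 1)) atTop (𝓝 0)) (k : ℕ) :
    Tendsto (fun j => a (j * N + N - 1) / a (j * N + k)) atTop (𝓝 (α ((N : ℤ) - 1) / α k)) := by
  obtain ⟨K, hK0, hK⟩ := per_bound hN (α := fun k => α (k + 1) / α k)
    (fun k => div_pos (hαpos _) (hαpos _)) (fun k => by
      rw [hαper, add_right_comm, hαper])
  set c : ℕ → ℝ := fun n => a n / α n with hc
  have hcp : ∀ n, 0 < c n := fun n => div_pos (ha _) (hαpos _)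
  have h1 : Tendsto (fun n => c n / c (n + 1)) atTop (𝓝 1) := by
    rw [← tendsto_sub_nhds_zero_iff]
    have e : ∀ n : ℕ, c n / c (n + 1) - 1 = (a n / a (n + 1) - α n / α (n + 1)) * (α (n + 1) / α n) := by
      intro n
      have := (ha n).ne'; have := (ha (n+1)).ne'; have := (hαpos n).ne'; have := (hαpos (n+1)).ne'
      simp only [hc]; push_cast; field_simp
    simp_rw [e]
    apply squeeze_zero_norm (a := fun n : ℕ => |a n / a (n + 1) - α n / α (n + 1)| * K)
    · intro n
      rw [Real.norm_eq_abs, abs_mul]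
      apply mul_le_mul_of_nonneg_left _ (abs_nonneg _)
      rw [abs_of_pos (div_pos (hαpos _) (hαpos _))]
      exact hK n
    · simpa using hmod2.abs.mul_const K
  have h2 : ∀ k, Tendsto (fun n => c n / c (n + k)) atTop (𝓝 1) := by
    intro k
    induction k with
    | zero =>
      refine tendsto_const_nhds.congr fun n => ?_
      rw [add_zero, div_self (hcp n).ne']
    | succ k ih =>
      have := ih.mul (h1.comp (tendsto_add_atTop_nat k))
      rw [mul_one] at this
      refine this.congr fun n => ?_
      simp only [Function.comp]
      have := (hcp (n+k)).ne'
      have := (hcp (n+k+1)).ne'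
      rw [← add_assoc]
      field_simp
  have h3 := ((h2 k).comp (tendsto_jN hN 0)).div ((h2 (N - 1)).comp (tendsto_jN hN 0)) one_ne_zero
  have h4 := h3.mul_const (α ((N : ℤ) - 1) / α k)
  rw [div_one, one_mul] at h4
  refine h4.congr fun j => ?_
  simp only [Function.comp, add_zero, Pi.div_apply]
  have e1 : c (j * N + (N - 1)) = a (j * N + N - 1) / α ((N:ℤ) - 1) := by
    simp only [hc]
    have := per_nat hαper j ((N : ℤ) - 1)
    have e : ((j * N + (N - 1) : ℕ) : ℤ) = j * N + ((N : ℤ) - 1) := by push_cast [hN]; ring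
    rw [e, this, Nat.add_sub_assoc hN]
  have e2 : c (j * N + k) = a (j * N + k) / α k := by
    simp only [hc]
    have := per_nat hαper j k
    push_cast; rw [this]
  rw [e1, e2]
  have := (hcp (j * N)).ne'; have := (ha (j * N + N - 1)).ne'; have := (ha (j * N + k)).ne'
  have := (hαpos k).ne'; have := (hαpos ((N : ℤ) - 1)).ne'
  field_simp

/-- real limiting one-step matrix at 0 -/
noncomputable def Br (α β : ℤ → ℝ) (k : ℕ) : Matrix (Fin 2) (Fin 2) ℝ :=
  !![0, 1; -(α ((k : ℤ) - 1) / α k), -(β k / α k)]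

noncomputable def Tr (α β : ℤ → ℝ) : ℕ → Matrix (Fin 2) (Fin 2) ℝ
  | 0 => 1
  | k + 1 => Br α β k * Tr α β k

noncomputable def wk (α β : ℤ → ℝ) (k : ℕ) : Matrix (Fin 2) (Fin 2) ℝ :=
  !![-(Tr α β k 1 0 * Tr α β k 1 1), -(Tr α β k 1 1) ^ 2;
     (Tr α β k 1 0) ^ 2, Tr α β k 1 0 * Tr α β k 1 1]

noncomputable def Sr (N : ℕ) (α β : ℤ → ℝ) (σ θ : ℕ → ℝ) : ℕ → Matrix (Fin 2) (Fin 2) ℝ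
  | 0 => 0
  | k + 1 => Br α β k * Sr N α β σ θ k +
      !![0, 0; -(α ((N : ℤ) - 1) / α k * σ k), -(α ((N : ℤ) - 1) / α k * θ k)] * Tr α β k

noncomputable abbrev φ : Matrix (Fin 2) (Fin 2) ℝ →+* Matrix (Fin 2) (Fin 2) ℂ :=
  Complex.ofRealHom.mapMatrix

lemma det_Tr (α β : ℤ → ℝ) (hαpos : ∀ k, 0 < α k) (k : ℕ) :
    (Tr α β k).det = α (-1) / α ((k : ℤ) - 1) := by
  induction k with
  | zero => simp [Tr, (hαpos (-1)).ne']
  | succ k ih =>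
    rw [Tr, Matrix.det_mul, ih]
    have h1 := (hαpos k).ne'
    have h2 := (hαpos ((k : ℤ) - 1)).ne'
    simp only [Br, Matrix.det_fin_two_of]
    push_cast
    rw [add_sub_cancel_right]
    field_simp
    ring

lemma Tr_wk (α β : ℤ → ℝ) (hαpos : ∀ k, 0 < α k) (k : ℕ) :
    Tr α β (k + 1) * wk α β k = (!![0, 0; 0, α (-1) / α k] : Matrix (Fin 2) (Fin 2) ℝ) * Tr α β k := by
  have hd := det_Tr α β hαpos k
  rw [Matrix.det_fin_two] at hd
  have h1 := (hαpos k).ne'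
  have h2 := (hαpos ((k : ℤ) - 1)).ne'
  rw [eq_div_iff h2] at hd
  rw [Tr]
  ext i j
  fin_cases i <;> fin_cases j <;>
    simp [Br, wk, Matrix.mul_apply, Matrix.vecMul, dotProduct, Fin.sum_univ_two] <;> field_simp
  · ring
  · ring
  · linear_combination (Tr α β k 1 0) * hd
  · linear_combination (Tr α β k 1 1) * hd

lemma frakX_eq {N : ℕ} {α β : ℤ → ℝ} (hαper : ∀ k : ℤ, α (k + N) = α k)
    (hβper : ∀ k : ℤ, β (k + N) = β k) (M : ℕ) :
    frakX α β M (N : ℤ) 0 = φ (Tr α β M) := by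
  induction M with
  | zero => simp [frakX, Tr]
  | succ M ih =>
    have : frakX α β (M + 1) (N : ℤ) 0 = frakB α β (N + M) 0 * frakX α β M N 0 := by
      simp [frakX, List.range_succ]
    rw [this, ih, Tr, map_mul]
    congr 1
    have e1 : α (N + M) = α M := by rw [add_comm, hαper]
    have e2 : β (N + M) = β M := by rw [add_comm, hβper]
    have e3 : α ((N : ℤ) + M - 1) = α ((M : ℤ) - 1) := by rw [← hαper (M - 1)]; congr 1; ring
    ext i j
    fin_cases i <;> fin_cases j <;> simp [frakB, Br, e1, e2, e3, φ, neg_div]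

end JZ
end

section
open Filter Topology
namespace JZ

lemma tendsto_mat {f : ℕ → Matrix (Fin 2) (Fin 2) ℂ} {M : Matrix (Fin 2) (Fin 2) ℂ} :
    Tendsto f atTop (𝓝 M) ↔ ∀ i j, Tendsto (fun n => f n i j) atTop (𝓝 (M i j)) := by
  exact Iff.trans (tendsto_pi_nhds (A := fun _ : Fin 2 => Fin 2 → ℂ))
    (forall_congr' fun i => tendsto_pi_nhds)

lemma step_lim {N : ℕ} (a b : ℕ → ℝ) (ha : ∀ n, 0 < a n) (α β : ℤ → ℝ) 
    (hα1 : α (-1) = α ((N : ℤ) - 1))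
    (k : ℕ) (σ θ : ℝ)
    (hr : Tendsto (fun j => a (j * N + N - 1) / a (j * N + k)) atTop (𝓝 (α ((N : ℤ) - 1) / α k)))
    (hσ : Tendsto (fun j => a (j * N + k) * (a (j * N + k - 1) / a (j * N + k)
      - α ((k : ℤ) - 1) / α k)) atTop (𝓝 σ))
    (hθ : Tendsto (fun j => a (j * N + k) * (b (j * N + k) / a (j * N + k)
      - β k / α k)) atTop (𝓝 θ)) (z : ℂ) :
    Tendsto (fun j => (a (j * N + N - 1) : ℂ) • (jacobiB a b (j * N + k) z - φ (Br α β k))) atTop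
      (𝓝 (φ !![0, 0; -(α ((N : ℤ) - 1) / α k * σ), -(α ((N : ℤ) - 1) / α k * θ)]
        + z • φ !![0, 0; 0, α (-1) / α k])) := by
  have hrC : Tendsto (fun j => ((a (j * N + N - 1) / a (j * N + k) : ℝ) : ℂ)) atTop
    (𝓝 ((α ((N : ℤ) - 1) / α k : ℝ) : ℂ)) := (Complex.continuous_ofReal.tendsto _).comp hr
  rw [tendsto_mat]
  intro i l
  fin_cases i <;> fin_cases l
  · simp [jacobiB, Br, φ]
  · simp [jacobiB, Br, φ]
  · have := (Complex.continuous_ofReal.tendsto _).comp (hr.mul hσ).neg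
    have h2 : ((φ !![0, 0; -(α ((N : ℤ) - 1) / α k * σ), -(α ((N : ℤ) - 1) / α k * θ)]
        + z • φ !![0, 0; 0, α (-1) / α k]) 1 0) = ((-(α ((N : ℤ) - 1) / α k * σ) : ℝ) : ℂ) := by
      simp [φ]
    simp only [Fin.mk_one, Fin.zero_eta]
    rw [h2]
    refine this.congr fun j => ?_
    have h3 : (a (j * N + k) : ℂ) ≠ 0 := by exact_mod_cast (ha _).ne'
    simp [jacobiB, Br, φ]
    field_simp
    ring
  · have := hrC.mul (((Complex.continuous_ofReal.tendsto _).comp hθ).const_sub z)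
    have h2 : ((φ !![0, 0; -(α ((N : ℤ) - 1) / α k * σ), -(α ((N : ℤ) - 1) / α k * θ)]
        + z • φ !![0, 0; 0, α (-1) / α k]) 1 1) = ((α ((N : ℤ) - 1) / α k : ℝ) : ℂ) * (z - (θ : ℂ)) := by
      simp [φ, hα1]; ring
    simp only [Fin.mk_one]
    rw [h2]
    refine this.congr fun j => ?_
    have h3 : (a (j * N + k) : ℂ) ≠ 0 := by exact_mod_cast (ha _).ne'
    simp [jacobiB, Br, φ]
    field_simp
    ring

lemma transferX_succ (a b : ℕ → ℝ) (M n : ℕ) (z : ℂ) :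
    transferX a b (M + 1) n z = jacobiB a b (n + M) z * transferX a b M n z := by
  simp [transferX, List.range_succ]

lemma lim_of_smul {f : ℕ → Matrix (Fin 2) (Fin 2) ℂ} {T L : Matrix (Fin 2) (Fin 2) ℂ} {c : ℕ → ℝ}
    (hc : Tendsto c atTop atTop)
    (h : Tendsto (fun j => (c j : ℂ) • (f j - T)) atTop (𝓝 L)) : Tendsto f atTop (𝓝 T) := by
  have h1 : Tendsto (fun j => (((c j)⁻¹ : ℝ) : ℂ)) atTop (𝓝 0) := by
    have := (Complex.continuous_ofReal.tendsto _).comp hc.inv_tendsto_atTop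
    rw [Complex.ofReal_zero] at this
    exact this
  have h2 := (h1.smul h).add_const T
  rw [zero_smul, zero_add] at h2
  apply h2.congr'
  filter_upwards [hc.eventually_gt_atTop 0] with j hj
  have : (c j : ℂ) ≠ 0 := by exact_mod_cast hj.ne'
  rw [smul_smul, Complex.ofReal_inv, inv_mul_cancel₀ this, one_smul, sub_add_cancel]

lemma expand {N : ℕ} (hN : 1 ≤ N) (a b : ℕ → ℝ) (ha : ∀ n, 0 < a n) (α β : ℤ → ℝ)
    (hαpos : ∀ k, 0 < α k)
    (hα1 : α (-1) = α ((N : ℤ) - 1)) (hmod1 : Tendsto a atTop atTop)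
    (σ θ : ℕ → ℝ)
    (hr : ∀ k : ℕ, Tendsto (fun j => a (j * N + N - 1) / a (j * N + k)) atTop
      (𝓝 (α ((N : ℤ) - 1) / α k)))
    (hσ : ∀ k : ℕ, Tendsto (fun j => a (j * N + k) * (a (j * N + k - 1) / a (j * N + k)
      - α ((k : ℤ) - 1) / α k)) atTop (𝓝 (σ k)))
    (hθ : ∀ k : ℕ, Tendsto (fun j => a (j * N + k) * (b (j * N + k) / a (j * N + k)
      - β k / α k)) atTop (𝓝 (θ k))) (z : ℂ) (M : ℕ) :
    Tendsto (fun j => (a (j * N + N - 1) : ℂ) • (transferX a b M (j * N) z - φ (Tr α β M))) atTop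
      (𝓝 (φ (Sr N α β σ θ M) + z • φ (Tr α β M * ∑ k ∈ Finset.range M, wk α β k))) := by
  have hA : Tendsto (fun j => a (j * N + N - 1)) atTop atTop := by
    have := hmod1.comp (tendsto_jN hN (N - 1))
    refine this.congr fun j => ?_
    simp only [Function.comp]; rw [Nat.add_sub_assoc hN]
  induction M with
  | zero => simp [transferX, Tr, Sr]
  | succ M ih =>
    have hs := step_lim a b ha α β hα1 M (σ M) (θ M) (hr M) (hσ M) (hθ M) z
    have hB := lim_of_smul hA hs
    have := (hB.mul ih).add (hs.mul_const (φ (Tr α β M)))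
    have e : φ (Br α β M) * (φ (Sr N α β σ θ M) + z • φ (Tr α β M * ∑ k ∈ Finset.range M, wk α β k))
        + (φ !![0, 0; -(α ((N : ℤ) - 1) / α M * σ M), -(α ((N : ℤ) - 1) / α M * θ M)]
        + z • φ !![0, 0; 0, α (-1) / α M]) * φ (Tr α β M) =
        φ (Sr N α β σ θ (M + 1)) + z • φ (Tr α β (M + 1) * ∑ k ∈ Finset.range (M + 1), wk α β k) := by
      rw [Finset.sum_range_succ, mul_add (Tr α β (M + 1)), Tr_wk α β hαpos M, Sr, Tr]
      simp only [map_add, map_mul, smul_add, mul_add, add_mul, Matrix.mul_smul, Matrix.smul_mul, mul_assoc]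
      abel
    rw [e] at this
    refine this.congr fun j => ?_
    rw [transferX_succ, Tr, map_mul, Matrix.mul_smul, Matrix.smul_mul, ← smul_add]
    congr 1
    rw [mul_sub, sub_mul]; abel

end JZ
end

section
open Filter Topology
namespace JZ

lemma uvw_strict {N : ℕ} (hN : 2 ≤ N) (p q : ℕ → ℝ) (hp0 : p 0 = 0) (hq0 : q 0 = 1) (hp1 : p 1 ≠ 0) :
    0 < ∑ k ∈ Finset.range N, q k ^ 2 ∧
    (∑ k ∈ Finset.range N, p k * q k) ^ 2 <
      (∑ k ∈ Finset.range N, p k ^ 2) * (∑ k ∈ Finset.range N, q k ^ 2) := by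
  set u := ∑ k ∈ Finset.range N, p k * q k with hu
  set v := ∑ k ∈ Finset.range N, p k ^ 2 with hv
  set w := ∑ k ∈ Finset.range N, q k ^ 2 with hw
  have hw0 : 0 < w := by
    have := Finset.single_le_sum (f := fun k => q k ^ 2) (fun k _ => sq_nonneg _)
      (Finset.mem_range.2 (by omega : 0 < N))
    simp only [hq0] at this
    rw [hw]; linarith
  refine ⟨hw0, ?_⟩
  have e : ∑ k ∈ Finset.range N, (w * p k - u * q k) ^ 2 = w * (v * w - u ^ 2) := by
    have : ∀ k, (w * p k - u * q k) ^ 2 = w ^ 2 * p k ^ 2 - 2 * w * u * (p k * q k) + u ^ 2 * q k ^ 2 := by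
      intro k; ring
    simp_rw [this]
    rw [Finset.sum_add_distrib, Finset.sum_sub_distrib, ← Finset.mul_sum, ← Finset.mul_sum,
      ← Finset.mul_sum, ← hu, ← hv, ← hw]
    ring
  have hpos : 0 < ∑ k ∈ Finset.range N, (w * p k - u * q k) ^ 2 := by
    apply lt_of_le_of_ne (Finset.sum_nonneg fun k _ => sq_nonneg _)
    intro h0
    have hz := (Finset.sum_eq_zero_iff_of_nonneg (fun k _ => sq_nonneg _)).1 h0.symm
    have z0 := hz 0 (Finset.mem_range.2 (by omega))
    have z1 := hz 1 (Finset.mem_range.2 (by omega))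
    rw [hp0, hq0, sq_eq_zero_iff] at z0
    have : u = 0 := by linarith
    rw [this, sq_eq_zero_iff, zero_mul, sub_zero] at z1
    rcases mul_eq_zero.1 z1 with h | h
    · exact hw0.ne' h
    · exact hp1 h
  rw [e] at hpos
  have := pos_of_mul_pos_right hpos hw0.le
  linarith

lemma struct (N : ℕ) (hN : 1 ≤ N)
    (a b : ℕ → ℝ) (ha : ∀ n, 0 < a n)
    (α β : ℤ → ℝ) (hαpos : ∀ k, 0 < α k)
    (hαper : ∀ k : ℤ, α (k + N) = α k) (hβper : ∀ k : ℤ, β (k + N) = β k)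
    (hmod1 : Tendsto a atTop atTop)
    (hmod2 : Tendsto (fun n : ℕ => a n / a (n + 1) - α n / α (n + 1)) atTop (𝓝 0))
    (ε : ℝ) (hε : ε = 1 ∨ ε = -1)
    (hX : frakX α β N (N : ℤ) 0 = (ε : ℂ) • (1 : Matrix (Fin 2) (Fin 2) ℂ))
    (hD1a : MemD1N N (fun n => a (n + 1) * (a n / a (n + 1) - α n / α (n + 1))))
    (hD1b : MemD1N N (fun n => a n * (b n / a n - β n / α n))) :
    ∃ ra rb rc rd u v w : ℝ, 0 < w ∧ u ^ 2 < v * w ∧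
      (∀ z : ℂ,
        Tendsto (fun j => (ε : ℂ) * a (j * N + N - 1) * (transferX a b N (j * N) z 0 0 - ε)) atTop
          (𝓝 (ra - z * u)) ∧
        Tendsto (fun j => (ε : ℂ) * a (j * N + N - 1) * (transferX a b N (j * N) z 0 1)) atTop
          (𝓝 (rb - z * w)) ∧
        Tendsto (fun j => (ε : ℂ) * a (j * N + N - 1) * (transferX a b N (j * N) z 1 0)) atTop
          (𝓝 (rc + z * v)) ∧
        Tendsto (fun j => (ε : ℂ) * a (j * N + N - 1) * (transferX a b N (j * N) z 1 1 - ε)) atTop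
          (𝓝 (rd + z * u))) ∧
      (∀ z : ℂ, ∀ i : ℕ, Tendsto (fun j => transferX a b i (j * N) z) atTop (𝓝 (φ (Tr α β i)))) := by
  have hα1 : α (-1) = α ((N : ℤ) - 1) := by rw [← hαper (-1), neg_add_eq_sub]
  have hr := ratio_lim hN a ha α hαpos hαper hmod2
  have hσ : ∀ k : ℕ, ∃ σ, Tendsto (fun j => a (j * N + k) * (a (j * N + k - 1) / a (j * N + k)
      - α ((k : ℤ) - 1) / α k)) atTop (𝓝 σ) := by
    intro k
    obtain ⟨l, hl⟩ := memD1N_lim hN hD1a (N + k - 1)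
    refine ⟨l, ?_⟩
    rw [← tendsto_add_atTop_iff_nat 1]
    refine hl.congr fun j => ?_
    have e1 : j * N + (N + k - 1) + 1 = (j + 1) * N + k := by rw [add_mul]; omega
    have e2 : j * N + (N + k - 1) = (j + 1) * N + k - 1 := by omega
    have e4 : (((j + 1) * N + k - 1 : ℕ) : ℤ) = ((j + 1 : ℕ) : ℤ) * N + ((k : ℤ) - 1) := by
      have : 1 ≤ (j + 1) * N + k := by rw [add_mul]; omega
      push_cast [this]; ring
    have e3 : α (((j + 1) * N + k - 1 : ℕ)) = α ((k : ℤ) - 1) := by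
      rw [e4]; exact per_nat hαper _ _
    have e5 : α ((((j + 1) * N + k - 1 : ℕ) : ℤ) + 1) = α k := by
      rw [e4, add_assoc, per_nat hαper]; congr 1; ring
    beta_reduce
    rw [e1, e2, e3, e5]
  have hθ : ∀ k : ℕ, ∃ θ, Tendsto (fun j => a (j * N + k) * (b (j * N + k) / a (j * N + k)
      - β k / α k)) atTop (𝓝 θ) := by
    intro k
    obtain ⟨l, hl⟩ := memD1N_lim hN hD1b k
    refine ⟨l, hl.congr fun j => ?_⟩
    have e1 : α ((j * N + k : ℕ)) = α k := by push_cast; exact per_nat hαper _ _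
    have e2 : β ((j * N + k : ℕ)) = β k := by push_cast; exact per_nat hβper _ _
    beta_reduce
    rw [e1, e2]
  choose σ hσ using hσ
  choose θ hθ using hθ
  have hex := expand hN a b ha α β hαpos hα1 hmod1 σ θ hr hσ hθ
  have hA : Tendsto (fun j => a (j * N + N - 1)) atTop atTop := by
    have := hmod1.comp (tendsto_jN hN (N - 1))
    refine this.congr fun j => ?_
    simp only [Function.comp]; rw [Nat.add_sub_assoc hN]
  have hε2 : ε * ε = 1 := by rcases hε with h | h <;> rw [h] <;> norm_num
  have hT : ∀ i j, Tr α β N i j = (ε • (1 : Matrix (Fin 2) (Fin 2) ℝ)) i j := by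
    intro i j
    rw [frakX_eq hαper hβper] at hX
    have := congrFun (congrFun hX i) j
    have h2 : ((Tr α β N i j : ℝ) : ℂ) = (((ε • (1 : Matrix (Fin 2) (Fin 2) ℝ)) i j : ℝ) : ℂ) := by
      have h3 : (φ (Tr α β N)) i j = ((Tr α β N i j : ℝ) : ℂ) := rfl
      rw [← h3, this]
      simp only [Matrix.smul_apply, Matrix.one_apply]
      split_ifs <;> simp
    exact_mod_cast h2
  have hTN : Tr α β N = ε • 1 := by ext i j; exact hT i j
  have hN2 : 2 ≤ N := by
    by_contra h
    have h1 : N = 1 := by omega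
    have := hT 0 0
    rw [h1] at this
    simp [Tr, Br] at this
    rw [← this] at hε2
    norm_num at hε2
  have huvw := uvw_strict hN2 (fun k => Tr α β k 1 0) (fun k => Tr α β k 1 1) (by simp [Tr]) (by simp [Tr])
    (by simp [Tr, Br]; exact ⟨(hαpos _).ne', (hαpos _).ne'⟩)
  refine ⟨ε * Sr N α β σ θ N 0 0, ε * Sr N α β σ θ N 0 1, ε * Sr N α β σ θ N 1 0, ε * Sr N α β σ θ N 1 1,
    _, _, _, huvw.1, huvw.2, ?_, ?_⟩
  · intro z
    have h := hex z N
    rw [hTN] at h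
    rw [tendsto_mat] at h
    have hεC : (ε : ℂ) * ε = 1 := by exact_mod_cast hε2
    have hsum : ∀ i j, (∑ k ∈ Finset.range N, wk α β k) i j = ∑ k ∈ Finset.range N, wk α β k i j := by
      intro i j; rw [Matrix.sum_apply]
    have s00 : (∑ k ∈ Finset.range N, wk α β k) 0 0 = -∑ k ∈ Finset.range N, Tr α β k 1 0 * Tr α β k 1 1 := by
      rw [hsum, ← Finset.sum_neg_distrib]; rfl
    have s01 : (∑ k ∈ Finset.range N, wk α β k) 0 1 = -∑ k ∈ Finset.range N, Tr α β k 1 1 ^ 2 := by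
      rw [hsum, ← Finset.sum_neg_distrib]; rfl
    have s10 : (∑ k ∈ Finset.range N, wk α β k) 1 0 = ∑ k ∈ Finset.range N, Tr α β k 1 0 ^ 2 := by
      rw [hsum]; rfl
    have s11 : (∑ k ∈ Finset.range N, wk α β k) 1 1 = ∑ k ∈ Finset.range N, Tr α β k 1 0 * Tr α β k 1 1 := by
      rw [hsum]; rfl
    refine ⟨?_, ?_, ?_, ?_⟩
    · have := (h 0 0).const_mul (ε : ℂ)
      convert this using 2
      · simp [φ, mul_assoc]
      · simp [φ, s00, mul_add]
        rw [mul_left_comm, ← mul_assoc (ε : ℂ), hεC]; ring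
    · have := (h 0 1).const_mul (ε : ℂ)
      convert this using 2
      · simp [φ, mul_assoc]
      · simp [φ, s01, mul_add]
        rw [mul_left_comm, ← mul_assoc (ε : ℂ), hεC]; ring
    · have := (h 1 0).const_mul (ε : ℂ)
      convert this using 2
      · simp [φ, mul_assoc]
      · simp [φ, s10, mul_add]
        rw [mul_left_comm, ← mul_assoc (ε : ℂ), hεC]; ring
    · have := (h 1 1).const_mul (ε : ℂ)
      convert this using 2
      · simp [φ, mul_assoc]
      · simp [φ, s11, mul_add]
        rw [mul_left_comm, ← mul_assoc (ε : ℂ), hεC]; ring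
  · intro z i
    exact lim_of_smul hA (hex z i)

end JZ
end

section
open Filter Topology
namespace JZ

noncomputable def PQ (a b : ℕ → ℝ) : ℕ → Polynomial ℝ
  | 0 => 1
  | 1 => Polynomial.C (1 / a 0) * (Polynomial.X - Polynomial.C (b 0))
  | n + 2 => Polynomial.C (1 / a (n + 1)) * ((Polynomial.X - Polynomial.C (b (n + 1))) * PQ a b (n + 1)
      - Polynomial.C (a n) * PQ a b n)

noncomputable def PC (a b : ℕ → ℝ) (n : ℕ) (z : ℂ) : ℂ := Polynomial.aeval z (PQ a b n)

lemma PC_zero (a b : ℕ → ℝ) (z : ℂ) : PC a b 0 z = 1 := by simp [PC, PQ]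
lemma PC_one (a b : ℕ → ℝ) (z : ℂ) : PC a b 1 z = (z - b 0) / a 0 := by
  simp [PC, PQ]; ring
lemma PC_rec (a b : ℕ → ℝ) (ha : ∀ n, 0 < a n) (n : ℕ) (z : ℂ) :
    a (n + 1) * PC a b (n + 2) z = (z - b (n + 1)) * PC a b (n + 1) z - a n * PC a b n z := by
  have : (a (n + 1) : ℂ) ≠ 0 := by exact_mod_cast (ha _).ne'
  simp [PC, PQ]; field_simp

lemma PQ_deg (a b : ℕ → ℝ) (ha : ∀ n, 0 < a n) (n : ℕ) :
    ((PQ a b n).natDegree ≤ n ∧ 0 < (PQ a b n).coeff n) ∧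
    ((PQ a b (n + 1)).natDegree ≤ n + 1 ∧ 0 < (PQ a b (n + 1)).coeff (n + 1)) := by
  induction n with
  | zero =>
    refine ⟨by simp [PQ], ?_, ?_⟩
    · simp only [PQ]; compute_degree
    · simp [PQ, ha 0, Polynomial.coeff_X]
  | succ n ih =>
    obtain ⟨⟨h1, h2⟩, h3, h4⟩ := ih
    refine ⟨⟨h3, h4⟩, ?_, ?_⟩
    · rw [PQ]
      refine (Polynomial.natDegree_C_mul_le _ _).trans ?_
      refine (Polynomial.natDegree_sub_le _ _).trans (max_le ?_ ?_)
      · refine Polynomial.natDegree_mul_le.trans ?_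
        have := Polynomial.natDegree_X_sub_C (b (n + 1))
        omega
      · exact (Polynomial.natDegree_C_mul_le _ _).trans (by omega)
    · rw [PQ, Polynomial.coeff_C_mul, Polynomial.coeff_sub, sub_mul, Polynomial.coeff_sub,
        Polynomial.coeff_X_mul, Polynomial.coeff_C_mul, Polynomial.coeff_C_mul,
        Polynomial.coeff_eq_zero_of_natDegree_lt (p := PQ a b (n + 1)) (n := n + 1 + 1) (by omega),
        Polynomial.coeff_eq_zero_of_natDegree_lt (p := PQ a b n) (n := n + 1 + 1) (by omega)]
      have := ha (n + 1)
      simp; positivity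

lemma PQ_eval (a b : ℕ → ℝ) (ha : ∀ n, 0 < a n) (p : ℕ → ℝ → ℝ)
    (hp0 : ∀ x : ℝ, p 0 x = 1)
    (hp1 : ∀ x : ℝ, p 1 x = (x - b 0) / a 0)
    (hprec : ∀ n : ℕ, ∀ x : ℝ,
      a n * p n x + b (n + 1) * p (n + 1) x + a (n + 1) * p (n + 2) x = x * p (n + 1) x)
    (x : ℝ) (n : ℕ) : (PQ a b n).eval x = p n x ∧ (PQ a b (n + 1)).eval x = p (n + 1) x := by
  induction n with
  | zero => simp [PQ, hp0, hp1]; ring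
  | succ n ih =>
    refine ⟨ih.2, ?_⟩
    have h := hprec n x
    have := (ha (n + 1)).ne'
    rw [PQ]
    simp [ih.1, ih.2]
    field_simp
    linarith

lemma norm_PC (a b : ℕ → ℝ) (ha : ∀ n, 0 < a n) (n : ℕ) (S : Finset ℝ) (hS : S.card = n)
    (hr : ∀ y ∈ S, (PQ a b n).eval y = 0) :
    ∃ c : ℝ, 0 < c ∧ ∀ z : ℂ, ‖PC a b n z‖ = c * ∏ y ∈ S, ‖z - y‖ := by
  obtain ⟨h1, h2⟩ := (PQ_deg a b ha n).1
  have hne : PQ a b n ≠ 0 := by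
    intro h; rw [h] at h2; simp at h2
  have hdeg : (PQ a b n).natDegree = n := le_antisymm h1 (Polynomial.le_natDegree_of_ne_zero h2.ne')
  have hroots := Polynomial.roots_eq_of_natDegree_le_card_of_ne_zero hr (by rw [hS]; exact h1) hne
  have hfac := Polynomial.C_leadingCoeff_mul_prod_multiset_X_sub_C (p := PQ a b n)
    (by rw [hroots, hdeg]; exact hS)
  refine ⟨(PQ a b n).leadingCoeff, by rw [Polynomial.leadingCoeff, hdeg]; exact h2, fun z => ?_⟩
  have hlc : 0 < (PQ a b n).leadingCoeff := by rw [Polynomial.leadingCoeff, hdeg]; exact h2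
  rw [hroots] at hfac
  have hfac2 : Polynomial.C (PQ a b n).leadingCoeff * ∏ y ∈ S, (Polynomial.X - Polynomial.C y)
    = PQ a b n := hfac
  unfold PC
  conv_lhs => rw [← hfac2]
  rw [map_mul, norm_mul, map_prod, norm_prod]
  simp [abs_of_pos hlc]

lemma logsum (a b : ℕ → ℝ) (ha : ∀ n, 0 < a n) (n : ℕ) (S : Finset ℝ) (hS : S.card = n)
    (hr : ∀ y ∈ S, (PQ a b n).eval y = 0) (x t s : ℝ) (ht : 0 < t) (hs : 0 < s) :
    ∑ y ∈ S, (Real.log ((x - y) ^ 2 + t) - Real.log ((x - y) ^ 2 + s)) =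
      2 * (Real.log ‖PC a b n (x + √t * Complex.I)‖ - Real.log ‖PC a b n (x + √s * Complex.I)‖) := by
  obtain ⟨c, hc, hP⟩ := norm_PC a b ha n S hS hr
  have key : ∀ t : ℝ, 0 < t → 2 * Real.log ‖PC a b n (x + √t * Complex.I)‖ =
      2 * Real.log c + ∑ y ∈ S, Real.log ((x - y) ^ 2 + t) := by
    intro t ht
    have hn : ∀ y : ℝ, ‖(x + √t * Complex.I - y : ℂ)‖ ^ 2 = (x - y) ^ 2 + t := by
      intro y
      rw [← Complex.normSq_eq_norm_sq, Complex.normSq_apply]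
      simp [Real.mul_self_sqrt ht.le, pow_two]
    have hn0 : ∀ y : ℝ, ‖(x + √t * Complex.I - y : ℂ)‖ ≠ 0 := by
      intro y h0
      have := hn y
      rw [h0] at this
      nlinarith [sq_nonneg (x - y)]
    rw [hP, Real.log_mul hc.ne' (Finset.prod_ne_zero_iff.2 fun y _ => hn0 y),
      Real.log_prod (fun y _ => hn0 y), mul_add, Finset.mul_sum]
    congr 1
    refine Finset.sum_congr rfl fun y _ => ?_
    rw [← hn, Real.log_pow]; norm_num
  rw [Finset.sum_sub_distrib, mul_sub, key t ht, key s hs]; ring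

lemma herglotz (a b : ℕ → ℝ) (ha : ∀ n, 0 < a n) (z : ℂ) (hz : 0 < z.im) (n : ℕ) :
    0 < (PC a b (n + 1) z * (starRingEnd ℂ) (PC a b n z)).im := by
  induction n with
  | zero =>
    have : ((z - b 0) / a 0 : ℂ).im = z.im / a 0 := by
      rw [Complex.div_ofReal_im]; simp
    rw [PC_zero, PC_one, map_one, mul_one, this]
    exact div_pos hz (ha 0)
  | succ n ih =>
    have h := PC_rec a b ha n z
    have e : (a (n + 1) : ℂ) * (PC a b (n + 2) z * (starRingEnd ℂ) (PC a b (n + 1) z)) =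
        (z - b (n + 1)) * (Complex.normSq (PC a b (n + 1) z) : ℂ)
          - a n * (PC a b n z * (starRingEnd ℂ) (PC a b (n + 1) z)) := by
      rw [← mul_assoc, h, ← Complex.mul_conj]; ring
    have e2 := congrArg Complex.im e
    rw [Complex.im_ofReal_mul, Complex.sub_im, Complex.im_mul_ofReal, Complex.im_ofReal_mul] at e2
    have e3 : (PC a b n z * (starRingEnd ℂ) (PC a b (n + 1) z)).im =
        -(PC a b (n + 1) z * (starRingEnd ℂ) (PC a b n z)).im := by
      simp; ring
    rw [e3] at e2
    have h5 : 0 ≤ (z - b (n + 1)).im * Complex.normSq (PC a b (n + 1) z) := by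
      simp; exact mul_nonneg hz.le (Complex.normSq_nonneg _)
    have h6 := mul_pos (ha n) ih
    have : 0 < a (n + 1) * (PC a b (n + 2) z * (starRingEnd ℂ) (PC a b (n + 1) z)).im := by
      rw [e2]; linarith
    exact pos_of_mul_pos_right this (ha _).le

lemma PC_ne (a b : ℕ → ℝ) (ha : ∀ n, 0 < a n) (z : ℂ) (hz : 0 < z.im) (n : ℕ) : PC a b n z ≠ 0 := by
  intro h
  have := herglotz a b ha z hz n
  rw [h] at this; simp at this

lemma PC_im (a b : ℕ → ℝ) (ha : ∀ n, 0 < a n) (z : ℂ) (hz : 0 < z.im) (n : ℕ) :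
    0 < (PC a b (n + 1) z / PC a b n z).im := by
  have h := herglotz a b ha z hz n
  have h0 := PC_ne a b ha z hz n
  have e : PC a b (n + 1) z / PC a b n z =
      ((Complex.normSq (PC a b n z))⁻¹ : ℝ) * (PC a b (n + 1) z * (starRingEnd ℂ) (PC a b n z)) := by
    rw [div_eq_mul_inv, Complex.inv_def]; ring
  rw [e, Complex.im_ofReal_mul]
  exact mul_pos (inv_pos.2 (Complex.normSq_pos.2 h0)) h

lemma transfer_PC (a b : ℕ → ℝ) (ha : ∀ n, 0 < a n) (z : ℂ) (n i : ℕ) :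
    (transferX a b i (n + 1) z).mulVec ![PC a b n z, PC a b (n + 1) z] =
      ![PC a b (n + i) z, PC a b (n + 1 + i) z] := by
  induction i with
  | zero => simp [transferX]
  | succ i ih =>
    rw [transferX_succ, ← Matrix.mulVec_mulVec, ih]
    have h := PC_rec a b ha (n + i) z
    have h0 : (a (n + i + 1) : ℂ) ≠ 0 := by exact_mod_cast (ha _).ne'
    have e1 : n + 1 + i = n + i + 1 := by ring
    have e2 : n + 1 + (i + 1) = n + i + 2 := by ring
    have e3 : n + (i + 1) = n + i + 1 := by ring
    rw [e1, e2, e3]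
    ext k
    fin_cases k
    · simp [jacobiB, Matrix.mulVec, dotProduct, Fin.sum_univ_two]
    · simp [jacobiB, Matrix.mulVec, dotProduct, Fin.sum_univ_two]
      field_simp
      linear_combination -h

end JZ
end

section
open Filter Topology
namespace JZ

lemma tendsto_of_residues {N : ℕ} (hN : 1 ≤ N) (f : ℕ → ℝ) (l : ℝ)
    (h : ∀ r : ℕ, Tendsto (fun j => f (j * N + r)) atTop (𝓝 l)) : Tendsto f atTop (𝓝 l) := by
  rw [Metric.tendsto_atTop]
  intro e he
  have h1 : ∀ r, ∃ J, ∀ j ≥ J, dist (f (j * N + r)) l < e := fun r => (Metric.tendsto_atTop.1 (h r)) e he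
  choose J hJ using h1
  refine ⟨(∑ r ∈ Finset.range N, J r) * N, fun n hn => ?_⟩
  have hr : n % N < N := Nat.mod_lt _ hN
  have hq : ∑ r ∈ Finset.range N, J r ≤ n / N := (Nat.le_div_iff_mul_le hN).2 hn
  have hJ' : J (n % N) ≤ n / N :=
    (Finset.single_le_sum (f := J) (fun _ _ => Nat.zero_le _) (Finset.mem_range.2 hr)).trans hq
  have := hJ (n % N) (n / N) hJ'
  rwa [Nat.div_add_mod' n N] at this

lemma cesaro (g c : ℕ → ℝ) (L : ℝ) (hg : ∀ j, 0 < g j)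
    (hS : Tendsto (fun n => ∑ j ∈ Finset.range n, g j) atTop atTop) (hc : Tendsto c atTop (𝓝 L)) :
    Tendsto (fun n => (∑ j ∈ Finset.range n, g j * c j) / ∑ j ∈ Finset.range n, g j) atTop (𝓝 L) := by
  have ho : (fun j => g j * (c j - L)) =o[atTop] g := by
    have : (fun j => c j - L) =o[atTop] (fun _ => (1:ℝ)) := by
      rw [Asymptotics.isLittleO_one_iff]; simpa using hc.sub_const L
    simpa using (Asymptotics.isBigO_refl g atTop).mul_isLittleO this
  have hsum := ho.sum_range (fun j => (hg j).le) hS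
  have t3 := hsum.tendsto_div_nhds_zero.add_const L
  rw [zero_add] at t3
  apply t3.congr'
  filter_upwards [hS.eventually_gt_atTop 0] with n hn
  simp_rw [mul_sub, Finset.sum_sub_distrib, ← Finset.sum_mul]
  field_simp
  ring

lemma linear_bound {N : ℕ} (hN : 1 ≤ N) (a : ℕ → ℝ) (ha : ∀ n, 0 < a n)
    (α : ℤ → ℝ) (hαpos : ∀ k, 0 < α k) (hαper : ∀ k : ℤ, α (k + N) = α k)
    (hD1a : MemD1N N (fun n => a (n + 1) * (a n / a (n + 1) - α n / α (n + 1)))) :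
    ∃ C : ℝ, 0 < C ∧ ∀ n : ℕ, a n ≤ C * (n + 1) := by
  obtain ⟨K, hK0, hK⟩ := per_bound hN hαpos hαper
  obtain ⟨K', hK0', hK'⟩ := per_bound hN (α := fun k => 1 / α k)
    (fun k => div_pos one_pos (hαpos _)) (fun k => by simp only [hαper])
  obtain ⟨⟨M, hM⟩, -⟩ := hD1a
  have hM0 : 0 ≤ M := (abs_nonneg _).trans (hM 0)
  have h1 : ∀ n : ℕ, a (n + 1) / α ((n + 1 : ℕ) : ℤ) ≤ a n / α n + M * K' := by
    intro n
    have e : a (n + 1) / α ((n + 1 : ℕ) : ℤ) = a n / α n -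
        (a (n + 1) * (a n / a (n + 1) - α n / α (n + 1))) * (1 / α n) := by
      have := (ha (n+1)).ne'; have := (hαpos n).ne'; have := (hαpos (n+1)).ne'
      push_cast; field_simp; ring
    rw [e, sub_eq_add_neg, ← neg_mul]
    have hp : 0 < 1 / α n := div_pos one_pos (hαpos _)
    have := mul_le_mul ((neg_le_abs _).trans (hM n)) (hK' n) hp.le hM0
    linarith
  have h2 : ∀ n : ℕ, a n / α n ≤ a 0 / α 0 + n * (M * K') := by
    intro n
    induction n with
    | zero => simp
    | succ n ih => refine (h1 n).trans ?_; push_cast; linarith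
  have p0 : 0 < a 0 / α 0 := div_pos (ha _) (hαpos _)
  refine ⟨K * (a 0 / α 0 + M * K'), by positivity, fun n => ?_⟩
  have h3 : a n ≤ α n * (a 0 / α 0 + n * (M * K')) := by
    have := (div_le_iff₀ (hαpos n)).1 (h2 n)
    linarith
  refine h3.trans ?_
  rw [mul_assoc]
  apply mul_le_mul (hK n) _ (by positivity) hK0.le
  have : 0 ≤ M * K' := by positivity
  have hn : (0:ℝ) ≤ n := by positivity
  nlinarith [mul_nonneg p0.le hn]

lemma diverge {N : ℕ} (hN : 1 ≤ N) (a : ℕ → ℝ) (ha : ∀ n, 0 < a n)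
    (α : ℤ → ℝ) (hαpos : ∀ k, 0 < α k) (hαper : ∀ k : ℤ, α (k + N) = α k)
    (hD1a : MemD1N N (fun n => a (n + 1) * (a n / a (n + 1) - α n / α (n + 1)))) :
    Tendsto (fun n => ∑ j ∈ Finset.range n, (a ((j + 1) * N + N - 1))⁻¹) atTop atTop := by
  obtain ⟨C, hC, h⟩ := linear_bound hN a ha α hαpos hαper hD1a
  have hN' : (1:ℝ) ≤ N := by exact_mod_cast hN
  have key : ∀ j : ℕ, (1 / (2 * C * N)) * (1 / ((j:ℝ) + 1)) ≤ (a ((j + 1) * N + N - 1))⁻¹ := by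
    intro j
    rw [← one_div_mul_one_div_rev, one_div_mul_one_div_rev, one_div_mul_one_div_rev, ← one_div]
    apply one_div_le_one_div_of_le (ha _)
    refine (h _).trans ?_
    have : (((j + 1) * N + N - 1 : ℕ) : ℝ) + 1 = (j + 1) * N + N := by
      rw [Nat.cast_sub (by nlinarith)]; push_cast; ring
    rw [this]
    have hj : (0:ℝ) ≤ j := by positivity
    nlinarith [mul_nonneg (mul_nonneg hC.le hj) (zero_le_one.trans hN')]
  have t := Real.tendsto_sum_range_one_div_nat_succ_atTop.const_mul_atTop
    (show 0 < 1 / (2 * C * N) by positivity)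
  refine tendsto_atTop_mono (fun n => ?_) t
  rw [Finset.mul_sum]
  exact Finset.sum_le_sum fun j _ => key j

lemma rho_lim {N : ℕ} (hN : 1 ≤ N) (a : ℕ → ℝ) (ha : ∀ n, 0 < a n)
    (α : ℤ → ℝ) (hαpos : ∀ k, 0 < α k) (hαper : ∀ k : ℤ, α (k + N) = α k)
    (hmod1 : Tendsto a atTop atTop)
    (hmod2 : Tendsto (fun n : ℕ => a n / a (n + 1) - α n / α (n + 1)) atTop (𝓝 0))
    (hS : Tendsto (fun n => ∑ j ∈ Finset.range n, (a ((j + 1) * N + N - 1))⁻¹) atTop atTop) (r : ℕ) :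
    Tendsto (fun j => (∑ k ∈ Finset.range ((j * N + r) + N), α k / a k) /
      ∑ i ∈ Finset.range j, (a ((i + 1) * N + N - 1))⁻¹) atTop (𝓝 (N * α ((N : ℤ) - 1))) := by
  have hb : Tendsto (fun i => ∑ k ∈ Finset.range N, α k * (a ((i + 1) * N + N - 1) / a ((i + 1) * N + k)))
      atTop (𝓝 (N * α ((N : ℤ) - 1))) := by
    have : (N * α ((N : ℤ) - 1)) = ∑ k ∈ Finset.range N, α k * (α ((N : ℤ) - 1) / α k) := by
      rw [Finset.sum_congr rfl (g := fun _ => α ((N : ℤ) - 1))]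
      · simp
      · intro k _; have := (hαpos k).ne'; field_simp
    rw [this]
    exact tendsto_finsetSum _ fun k _ => ((((tendsto_add_atTop_iff_nat 1).2
      (ratio_lim hN a ha α hαpos hαper hmod2 k))).const_mul _)
  have t1 := cesaro _ _ _ (fun j => inv_pos.2 (ha ((j + 1) * N + N - 1))) hS hb
  have t2 : Tendsto (fun j => ∑ k ∈ Finset.range r, α k / a (j * N + (N + k))) atTop (𝓝 0) := by
    have : (0:ℝ) = ∑ k ∈ Finset.range r, 0 := by simp
    rw [this]
    exact tendsto_finsetSum _ fun k _ => tendsto_const_nhds.div_atTop (hmod1.comp (tendsto_jN hN _))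
  have t3 := (t2.add_const (∑ k ∈ Finset.range N, α k / a k)).div_atTop hS
  have t4 := t1.add t3
  rw [add_zero] at t4
  refine t4.congr fun j => ?_
  rw [← add_div]
  congr 1
  have hper : ∀ i k : ℕ, α ((i * N + k : ℕ) : ℤ) = α k := fun i k => by
    have := per_nat hαper i k
    push_cast; exact this
  have e1 : ∀ j : ℕ, ∑ k ∈ Finset.range (j * N + N), α k / a k = ∑ k ∈ Finset.range N, α k / a k +
      ∑ i ∈ Finset.range j, (a ((i + 1) * N + N - 1))⁻¹ *
        ∑ k ∈ Finset.range N, α k * (a ((i + 1) * N + N - 1) / a ((i + 1) * N + k)) := by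
    intro j
    induction j with
    | zero => simp
    | succ j ih =>
      rw [Finset.sum_range_add, show (j + 1) * N = j * N + N by ring, ih, Finset.sum_range_succ, add_assoc,
        show (j + 1) * N = j * N + N by ring]
      congr 2
      rw [Finset.mul_sum]
      refine Finset.sum_congr rfl fun k _ => ?_
      have := hper (j + 1) k
      rw [show (j + 1) * N = j * N + N by ring] at this
      rw [this]
      have := (ha (j * N + N + N - 1)).ne'; have := (ha (j * N + N + k)).ne'
      field_simp
  rw [show j * N + r + N = (j * N + N) + r by ring, Finset.sum_range_add, e1]
  have e2 : ∑ x ∈ Finset.range r, α ((j * N + N + x : ℕ) : ℤ) / a (j * N + N + x) =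
      ∑ k ∈ Finset.range r, α k / a (j * N + (N + k)) := by
    refine Finset.sum_congr rfl fun k _ => ?_
    have := hper (j + 1) k
    rw [show (j + 1) * N = j * N + N by ring] at this
    rw [this, add_assoc]
  rw [e2]; ring

lemma pc_lim {N : ℕ} (hN : 1 ≤ N) (a b : ℕ → ℝ) (ha : ∀ n, 0 < a n)
    (α β : ℤ → ℝ) (hαpos : ∀ k, 0 < α k)
    (hmod1 : Tendsto a atTop atTop)
    (hS : Tendsto (fun n => ∑ j ∈ Finset.range n, (a ((j + 1) * N + N - 1))⁻¹) atTop atTop)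
    (ε : ℝ) (hε : ε = 1 ∨ ε = -1) (z r11 r12 r21 r22 lp lm mp mm : ℂ) (hz : 0 < z.im)
    (h11 : Tendsto (fun j => (ε : ℂ) * a (j * N + N - 1) * (transferX a b N (j * N) z 0 0 - ε)) atTop
          (𝓝 r11))
    (h12 : Tendsto (fun j => (ε : ℂ) * a (j * N + N - 1) * (transferX a b N (j * N) z 0 1)) atTop
          (𝓝 r12))
    (h21 : Tendsto (fun j => (ε : ℂ) * a (j * N + N - 1) * (transferX a b N (j * N) z 1 0)) atTop
          (𝓝 r21))
    (h22 : Tendsto (fun j => (ε : ℂ) * a (j * N + N - 1) * (transferX a b N (j * N) z 1 1 - ε)) atTop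
          (𝓝 r22))
    (hT : ∀ i : ℕ, Tendsto (fun j => transferX a b i (j * N) z) atTop (𝓝 (φ (Tr α β i))))
    (hmp : 0 < mp.im)
    (hmm : mm.im < 0) (hl : lm.re < lp.re)
    (k1 : r21 - mm * r11 = - lp * mm) (k2 : r22 - mm * r12 = lp)
    (k3 : r21 - mp * r11 = - lm * mp) (k4 : r22 - mp * r12 = lm)
    (k5 : r11 + r12 * mp = lp) (r : ℕ) :
    Tendsto (fun j => Real.log ‖PC a b ((j * N + r) + N) z‖ /
      ∑ i ∈ Finset.range j, (a ((i + 1) * N + N - 1))⁻¹) atTop (𝓝 lp.re) := by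
  have hε1 : |ε| = 1 := by rcases hε with h | h <;> simp [h]
  have hεε : (ε : ℂ) * ε = 1 := by rcases hε with h | h <;> simp [h]
  have hn1 : ∀ j, (j + 1) * N - 1 + 1 = (j + 1) * N := fun j => Nat.sub_add_cancel (by nlinarith)
  have htr : ∀ j i, (transferX a b i ((j + 1) * N) z).mulVec
      ![PC a b ((j + 1) * N - 1) z, PC a b ((j + 1) * N) z] =
      ![PC a b ((j + 1) * N - 1 + i) z, PC a b ((j + 1) * N + i) z] := by
    intro j i
    have := transfer_PC a b ha z ((j + 1) * N - 1) i
    rwa [hn1] at this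
  have row0 : ∀ j i, PC a b ((j + 1) * N - 1 + i) z =
      transferX a b i ((j + 1) * N) z 0 0 * PC a b ((j + 1) * N - 1) z
      + transferX a b i ((j + 1) * N) z 0 1 * PC a b ((j + 1) * N) z := by
    intro j i
    have := congrFun (htr j i) 0
    simpa [Matrix.mulVec, dotProduct, Fin.sum_univ_two] using this.symm
  have row1 : ∀ j i, PC a b ((j + 1) * N + i) z =
      transferX a b i ((j + 1) * N) z 1 0 * PC a b ((j + 1) * N - 1) z
      + transferX a b i ((j + 1) * N) z 1 1 * PC a b ((j + 1) * N) z := by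
    intro j i
    have := congrFun (htr j i) 1
    simpa [Matrix.mulVec, dotProduct, Fin.sum_univ_two] using this.symm
  have haC : ∀ n, (a n : ℂ) ≠ 0 := fun n => by exact_mod_cast (ha n).ne'
  obtain ⟨d1, d2⟩ := dynamics (fun j => PC a b ((j + 1) * N - 1) z) (fun j => PC a b ((j + 1) * N) z)
    (fun j => (ε : ℂ) * a ((j + 1) * N + N - 1) * (transferX a b N ((j + 1) * N) z 0 0 - ε))
    (fun j => (ε : ℂ) * a ((j + 1) * N + N - 1) * (transferX a b N ((j + 1) * N) z 0 1))
    (fun j => (ε : ℂ) * a ((j + 1) * N + N - 1) * (transferX a b N ((j + 1) * N) z 1 0))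
    (fun j => (ε : ℂ) * a ((j + 1) * N + N - 1) * (transferX a b N ((j + 1) * N) z 1 1 - ε))
    (fun j => (a ((j + 1) * N + N - 1))⁻¹) ε hε1 (fun j => inv_pos.2 (ha _))
    (by
      apply tendsto_inv_atTop_zero.comp (hmod1.comp _)
      have := (tendsto_jN hN (N - 1)).comp (tendsto_add_atTop_nat 1)
      refine this.congr fun j => ?_
      simp only [Function.comp]; omega)
    hS r11 r12 r21 r22 lp lm mp mm
    ((tendsto_add_atTop_iff_nat 1).2 h11) ((tendsto_add_atTop_iff_nat 1).2 h12)
    ((tendsto_add_atTop_iff_nat 1).2 h21) ((tendsto_add_atTop_iff_nat 1).2 h22)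
    (fun j => PC_ne a b ha z hz _)
    (fun j => by
      have := PC_im a b ha z hz ((j + 1) * N - 1)
      rw [hn1] at this; exact this.le)
    (fun j => by
      have h := row0 j N
      rw [show (j + 1) * N - 1 + N = (j + 1 + 1) * N - 1 by
        rw [add_mul (j+1)]; have := hn1 j; omega] at h
      rw [h]
      have := haC ((j + 1) * N + N - 1)
      push_cast
      field_simp
      linear_combination (-transferX a b N ((j + 1) * N) z 0 0 * PC a b ((j + 1) * N - 1) z
        - transferX a b N ((j + 1) * N) z 0 1 * PC a b ((j + 1) * N) z
        + ε * PC a b ((j + 1) * N - 1) z) * hεε)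
    (fun j => by
      have h := row1 j N
      rw [show (j + 1) * N + N = (j + 1 + 1) * N by ring] at h
      rw [h]
      have := haC ((j + 1) * N + N - 1)
      push_cast
      field_simp
      linear_combination (-transferX a b N ((j + 1) * N) z 1 0 * PC a b ((j + 1) * N - 1) z
        - transferX a b N ((j + 1) * N) z 1 1 * PC a b ((j + 1) * N) z
        + ε * PC a b ((j + 1) * N) z) * hεε)
    hmm hl k1 k2 k3 k4 k5
  have hT' := tendsto_mat.1 ((tendsto_add_atTop_iff_nat 1).2 (hT r))
  have q1 := (hT' 1 0).add ((hT' 1 1).mul d1)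
  set P := Tr α β r 1 0
  set Q := Tr α β r 1 1
  have hPQ : φ (Tr α β r) 1 0 + φ (Tr α β r) 1 1 * mp = (P : ℂ) + Q * mp := by
    simp [φ, P, Q]
  rw [hPQ] at q1
  have hne : (P : ℂ) + Q * mp ≠ 0 := by
    intro h0
    have hi := congrArg Complex.im h0
    simp at hi
    have hQ : Q = 0 := hi.resolve_right hmp.ne'
    rw [hQ] at h0
    have hP : P = 0 := by simpa using h0
    have hd := det_Tr α β hαpos r
    rw [Matrix.det_fin_two] at hd
    have : 0 < α (-1) / α ((r : ℤ) - 1) := div_pos (hαpos _) (hαpos _)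
    rw [← hd, show Tr α β r 1 0 = 0 from hP, show Tr α β r 1 1 = 0 from hQ] at this
    simp at this
  have q2 := ((Real.continuousAt_log (norm_ne_zero_iff.2 hne)).tendsto.comp q1.norm).div_atTop hS
  have q3 := d2.add q2
  rw [add_zero] at q3
  refine q3.congr fun j => ?_
  simp only [Function.comp]
  rw [← add_div]
  congr 1
  have hv := PC_ne a b ha z hz ((j + 1) * N - 1)
  have e : PC a b (j * N + r + N) z = PC a b ((j + 1) * N - 1) z * (transferX a b r ((j + 1) * N) z 1 0
      + transferX a b r ((j + 1) * N) z 1 1 * (PC a b ((j + 1) * N) z / PC a b ((j + 1) * N - 1) z)) := by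
    rw [show j * N + r + N = (j + 1) * N + r by ring, row1]
    field_simp
  have hne2 := PC_ne a b ha z hz (j * N + r + N)
  rw [e] at hne2
  rw [e, norm_mul, Real.log_mul (norm_ne_zero_iff.2 hv)
    (norm_ne_zero_iff.2 (right_ne_zero_of_mul hne2))]

end JZ
end


/-- Theorem C' = Theorem A:3a of the paper. -/
theorem stmt_19
    (N : ℕ) (hN : 1 ≤ N)
    (a b : ℕ → ℝ) (ha : ∀ n, 0 < a n)
    (α β : ℤ → ℝ) (hαpos : ∀ k, 0 < α k)
    (hαper : ∀ k : ℤ, α (k + N) = α k) (hβper : ∀ k : ℤ, β (k + N) = β k)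
    (hmod1 : Tendsto a atTop atTop)
    (hmod2 : Tendsto (fun n : ℕ => a n / a (n + 1) - α n / α (n + 1)) atTop (𝓝 0))
    (hmod3 : Tendsto (fun n : ℕ => b n / a n - β n / α n) atTop (𝓝 0))
    (p : ℕ → ℝ → ℝ)
    (hp0 : ∀ x : ℝ, p 0 x = 1)
    (hp1 : ∀ x : ℝ, p 1 x = (x - b 0) / a 0)
    (hprec : ∀ n : ℕ, ∀ x : ℝ,
      a n * p n x + b (n + 1) * p (n + 1) x + a (n + 1) * p (n + 2) x = x * p (n + 1) x)
    (Z : ℕ → Finset ℝ)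
    (hZcard : ∀ n, (Z n).card = n + 1)
    (hZ : ∀ n, ∀ y : ℝ, y ∈ Z n ↔ p (n + 1) y = 0)
    (ε : ℝ) (hε : ε = 1 ∨ ε = -1)
    (hX : frakX α β N (N : ℤ) 0 = (ε : ℂ) • (1 : Matrix (Fin 2) (Fin 2) ℂ))
    (hD1a : MemD1N N (fun n => a (n + 1) * (a n / a (n + 1) - α n / α (n + 1))))
    (hD1b : MemD1N N (fun n => a n * (b n / a n - β n / α n)))
    (hD1c : MemD1N N (fun n => 1 / a n))
    (ρ : ℕ → ℝ) (hρ : ∀ n, ρ n = ∑ k ∈ Finset.range (n + 1), α k / a k) :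
    ∃ A B C : ℝ, A < 0 ∧
      (∀ z : ℂ,
        Tendsto (fun j => ((a (j * N + N - 1) : ℂ)) ^ 2 * discr (transferX a b N (j * N) z))
          atTop (𝓝 ((A : ℂ) * z ^ 2 + (B : ℂ) * z + (C : ℂ)))) ∧
      ∀ f : ℝ → ℝ, Continuous f → (∃ Cf : ℝ, ∀ x : ℝ, (1 + x ^ 2) * |f x| ≤ Cf) →
        Tendsto (fun n => (ρ n)⁻¹ * ∑ y ∈ Z n, f y) atTop
          (𝓝 (∫ x in {x : ℝ | A * x ^ 2 + B * x + C < 0},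
            f x * ((1 / (4 * Real.pi * N * α ((N : ℤ) - 1))) *
              |2 * A * x + B| / Real.sqrt (-(A * x ^ 2 + B * x + C))))) := by
  have hS := JZ.diverge hN a ha α hαpos hαper hD1a
  obtain ⟨ra, rb, rc, rd, u, v, w, hw, huv, hlim, hT⟩ := JZ.struct N hN a b ha α β hαpos hαper hβper
    hmod1 hmod2 ε hε hX hD1a hD1b
  obtain ⟨A, hA⟩ : ∃ A : ℝ, A = 4 * (u ^ 2 - v * w) := ⟨_, rfl⟩
  obtain ⟨B, hB⟩ : ∃ B : ℝ, B = -4 * u * (ra - rd) + 4 * (rb * v - w * rc) := ⟨_, rfl⟩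
  obtain ⟨C, hC⟩ : ∃ C : ℝ, C = (ra - rd) ^ 2 + 4 * rb * rc := ⟨_, rfl⟩
  have hA0 : A < 0 := by rw [hA]; linarith
  have hΔ : 0 ≤ B ^ 2 - 4 * A * C := by
    have e : A * (rb / w) ^ 2 + B * (rb / w) + C = (ra - rd - 2 * u * (rb / w)) ^ 2 := by
      rw [hA, hB, hC]; field_simp; ring
    have e2 : B ^ 2 - 4 * A * C = (2 * A * (rb / w) + B) ^ 2
        + 4 * (-A) * (A * (rb / w) ^ 2 + B * (rb / w) + C) := by ring
    rw [e2, e]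
    have : 0 < -A := by linarith
    positivity
  have hαN := hαpos ((N : ℤ) - 1)
  have hN0 : (0:ℝ) < N := by exact_mod_cast hN
  refine ⟨A, B, C, hA0, ?_, ?_⟩
  · intro z
    obtain ⟨h11, h12, h21, h22⟩ := hlim z
    have t := ((h11.sub h22).pow 2).add ((h12.mul h21).const_mul 4)
    have e : (A : ℂ) * z ^ 2 + B * z + C =
        (ra - z * u - (rd + z * u)) ^ 2 + 4 * ((rb - z * w) * (rc + z * v)) := by
      rw [hA, hB, hC]; push_cast; ring
    rw [e]
    refine t.congr fun j => ?_
    have hεε : (ε : ℂ) ^ 2 = 1 := by rcases hε with h | h <;> simp [h]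
    simp only [discr, Matrix.trace_fin_two, Matrix.det_fin_two]
    linear_combination ((a (j * N + N - 1) : ℂ) ^ 2 *
      ((transferX a b N (j * N) z 0 0 - transferX a b N (j * N) z 1 1) ^ 2
        + 4 * transferX a b N (j * N) z 0 1 * transferX a b N (j * N) z 1 0)) * hεε
  · intro f hf hCf
    obtain ⟨Cf, hCf⟩ := hCf
    have hρ0 : ∀ n, 0 < ρ n := fun n => by
      rw [hρ]
      exact Finset.sum_pos (fun k _ => div_pos (hαpos _) (ha _)) ⟨0, by simp⟩
    have hpc : ∀ x τ : ℝ, 0 < τ → Tendsto (fun n => Real.log ‖JZ.PC a b (n + 1) (x + √τ * Complex.I)‖ / ρ n)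
        atTop (𝓝 (((ra + rd) + JZ.sg (A * x ^ 2 + B * x + C) (2 * A * x + B) A τ) / 2
          / (N * α ((N : ℤ) - 1)))) := by
      intro x τ hτ
      have hz : 0 < ((x : ℂ) + √τ * Complex.I).im := by simpa using hτ
      obtain ⟨lp, lm, mp, mm, hmp, hmm, hl, hlp, k1, k2, k3, k4, k5⟩ :=
        JZ.eig ra rb rc rd u v w x τ hw huv hτ A B C hA hB hC _ rfl
      obtain ⟨h11, h12, h21, h22⟩ := hlim (x + √τ * Complex.I)
      rw [← hlp, mul_div_cancel_left₀ _ two_ne_zero]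
      have hne : (N * α ((N : ℤ) - 1)) ≠ 0 := by positivity
      have key : Tendsto (fun n => Real.log ‖JZ.PC a b (n + N) (x + √τ * Complex.I)‖ /
          ∑ k ∈ Finset.range (n + N), α k / a k) atTop (𝓝 (lp.re / (N * α ((N : ℤ) - 1)))) := by
        refine JZ.tendsto_of_residues hN _ _ fun r => ?_
        have t1 := JZ.pc_lim hN a b ha α β hαpos hmod1 hS ε hε _ _ _ _ _ lp lm mp mm hz h11 h12 h21 h22
          (hT _) hmp hmm hl k1 k2 k3 k4 k5 r
        have t2 := JZ.rho_lim hN a ha α hαpos hαper hmod1 hmod2 hS r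
        refine (t1.div t2 hne).congr' ?_
        filter_upwards [hS.eventually_gt_atTop 0] with j hj
        exact div_div_div_cancel_right₀ hj.ne' _ _
      have key2 := (tendsto_add_atTop_iff_nat (f := fun n =>
        Real.log ‖JZ.PC a b n (x + √τ * Complex.I)‖ / ∑ k ∈ Finset.range n, α k / a k) N).1 key
      refine ((tendsto_add_atTop_iff_nat 1).2 key2).congr fun n => ?_
      rw [hρ]
    have hfin := JZ.final_analysis A B C (1 / (4 * N * α ((N : ℤ) - 1))) hA0 hΔ (by positivity) Z ρ hρ0
      (by
        intro x t s ht hs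
        have h := ((hpc x t ht).sub (hpc x s hs)).const_mul 2
        have e : ∀ n, (ρ n)⁻¹ * ∑ y ∈ Z n, (Real.log ((x - y) ^ 2 + t) - Real.log ((x - y) ^ 2 + s)) =
            2 * (Real.log ‖JZ.PC a b (n + 1) (x + √t * Complex.I)‖ / ρ n
              - Real.log ‖JZ.PC a b (n + 1) (x + √s * Complex.I)‖ / ρ n) := by
          intro n
          rw [JZ.logsum a b ha (n + 1) (Z n) (hZcard n) (fun y hy => by
            rw [(JZ.PQ_eval a b ha p hp0 hp1 hprec y (n + 1)).1]; exact (hZ n y).1 hy) x t s ht hs]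
          ring
        simp_rw [e]
        convert h using 2
        field_simp
        ring) f hf Cf hCf
    have e : Real.pi⁻¹ * (1 / (4 * N * α ((N : ℤ) - 1))) = 1 / (4 * Real.pi * N * α ((N : ℤ) - 1)) := by
      have := Real.pi_pos
      field_simp
    rw [e] at hfin
    exact hfin
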